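/- arXiv:1711.09245 — 7 statements merged into one kernel-verified Lean document; each statement's English description precedes it below -/
import Mathlib

section
/- Uniform distortion bound for all iterates. Assume the piecewise invertible setting and hypotheses (H1) and (H2) stated in the context. Then for every n ≥ 1 and every O ∈ P^n there is a version J of the Radon–Nikodym derivative of the pushforward of μ|_O under T^n with respect to μ such that J(u) ≤ e^{D·d(u,v)^α}·J(v) for all u,v ∈ T^n(O) with d(u,v) ≤ min{ε₂,ε₃}, where D = D̃/(1−s^α). -/
open MeasureTheory Set

theorem restrict_toMeasurable_ae_of_forall_mem {X : Type*} [MeasurableSpace X] {μ : Measure X}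
    [SFinite μ] {E : Set X} {P : X → Prop} (hP : MeasurableSet {x | P x})
    (h : ∀ x ∈ E, P x) : ∀ᵐ x ∂μ.restrict (toMeasurable μ E), P x := by
  change μ.restrict (toMeasurable μ E) {x | P x}ᶜ = 0
  rw [Measure.restrict_apply hP.compl, inter_comm,
    Measure.measure_toMeasurable_inter_of_sFinite hP.compl]
  convert measure_empty (μ := μ)
  ext x
  simpa using h x

theorem ContinuousOn.exists_measurable_eqOn {X : Type*} [TopologicalSpace X] [MeasurableSpace X]
    [BorelSpace X] {E : Set X} {f : X → ℝ} (hf : ContinuousOn f E) :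
    ∃ g : X → ℝ, Measurable g ∧ EqOn g f E := by
  have h : Measurable (E.domRestrict f) := hf.domRestrict.measurable
  obtain ⟨g, hg, hgf⟩ := Measurable.exists_eq_measurable_comp (f := (Subtype.val : E → X)) h
  exact ⟨g, hg, fun x hx => (congrFun hgf ⟨x, hx⟩).symm⟩

/-- `p` satisfies the bound `p u ≤ exp (D * dist u v ^ α) * p v` at points of `E` at distance at
most `ε`. -/
def DistortionBoundOn {X : Type*} [MetricSpace X] (E : Set X) (D α ε : ℝ) (p : X → ℝ) : Prop :=
  ∀ u ∈ E, ∀ v ∈ E, dist u v ≤ ε → p u ≤ Real.exp (D * dist u v ^ α) * p v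

theorem DistortionBoundOn.congr {X : Type*} [MetricSpace X] {E : Set X} {D α ε : ℝ} {p q : X → ℝ}
    (h : DistortionBoundOn E D α ε p) (hpq : EqOn q p E) : DistortionBoundOn E D α ε q := by
  intro u hu v hv huv
  rw [hpq hu, hpq hv]
  exact h u hu v hv huv

theorem DistortionBoundOn.continuousOn {X : Type*} [MetricSpace X] {E : Set X} {D α ε : ℝ}
    {p : X → ℝ} (h : DistortionBoundOn E D α ε p) (hα : 0 < α) (hε : 0 < ε) :
    ContinuousOn p E := by
  intro v hv
  have hd : Filter.Tendsto (fun u => D * dist u v ^ α) (nhdsWithin v E) (nhds 0) := by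
    have hc : Continuous fun u => D * dist u v ^ α :=
      continuous_const.mul ((continuous_id.dist continuous_const).rpow_const
        fun _ => Or.inr hα.le)
    simpa [Real.zero_rpow hα.ne'] using (hc.tendsto v).mono_left nhdsWithin_le_nhds
  have hup : Filter.Tendsto (fun u => Real.exp (D * dist u v ^ α) * p v)
      (nhdsWithin v E) (nhds (p v)) := by
    simpa using ((Real.continuous_exp.tendsto 0).comp hd).mul_const (p v)
  have hlow : Filter.Tendsto (fun u => Real.exp (-(D * dist u v ^ α)) * p v)
      (nhdsWithin v E) (nhds (p v)) := by
    have hd' := hd.neg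
    rw [neg_zero] at hd'
    simpa using ((Real.continuous_exp.tendsto 0).comp hd').mul_const (p v)
  have hnear : ∀ᶠ u in nhdsWithin v E, u ∈ E ∧ dist u v ≤ ε :=
    Filter.Eventually.and self_mem_nhdsWithin
      (nhdsWithin_le_nhds (Metric.closedBall_mem_nhds v hε))
  refine tendsto_of_tendsto_of_tendsto_of_le_of_le' hlow hup ?_ ?_
  · filter_upwards [hnear] with u ⟨hu, huv⟩
    have hvu := h v hv u hu (by rwa [dist_comm])
    rw [dist_comm v u] at hvu
    rw [Real.exp_neg, inv_mul_le_iff₀ (Real.exp_pos _)]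
    exact hvu
  · filter_upwards [hnear] with u ⟨hu, huv⟩
    exact h u hu v hv huv

/-- `p` is a measurable function which dominates the pushforward of `μ` restricted to `C` under
`S`, and which is its density on the measurable subsets of the (possibly nonmeasurable) image
`S '' C`. -/
structure IsImageDensity {X : Type*} [MeasurableSpace X] (μ : Measure X) (S : X → X) (C : Set X)
    (p : X → ℝ) : Prop where
  measurable : Measurable p
  pos : ∀ u ∈ S '' C, 0 < p u
  le_setLIntegral : ∀ A, MeasurableSet A →
    μ (C ∩ S ⁻¹' A) ≤ ∫⁻ x in A, ENNReal.ofReal (p x) ∂μ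
  eq_setLIntegral : ∀ B, MeasurableSet B → B ⊆ S '' C →
    μ (C ∩ S ⁻¹' B) = ∫⁻ x in B, ENNReal.ofReal (p x) ∂μ

theorem IsImageDensity.of_forall_setLIntegral_eq {X : Type*} [MeasurableSpace X] {μ : Measure X}
    [SFinite μ] {S : X → X} {C : Set X} {J p : X → ℝ} (hp : Measurable p)
    (hpJ : EqOn p J (S '' C)) (hJ : ∀ x ∈ S '' C, 0 < J x)
    (hRN : ∀ A, MeasurableSet A →
      μ (C ∩ S ⁻¹' A) = ∫⁻ x in A, ENNReal.ofReal (J x) ∂μ) :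
    IsImageDensity μ S C p where
  measurable := hp
  pos u hu := by rw [hpJ hu]; exact hJ u hu
  le_setLIntegral A hA := by
    set H := toMeasurable μ (S '' C) with hH
    have hHm : MeasurableSet H := measurableSet_toMeasurable _ _
    have hcap : C ∩ S ⁻¹' A = C ∩ S ⁻¹' (A ∩ H) := by
      ext x
      simp only [mem_inter_iff, mem_preimage]
      exact ⟨fun h => ⟨h.1, h.2, subset_toMeasurable _ _ ⟨x, h.1, rfl⟩⟩, fun h => ⟨h.1, h.2.1⟩⟩
    rw [hcap, hRN _ (hA.inter hHm)]
    obtain ⟨g, hg, hgJ, hgeq⟩ := exists_measurable_le_lintegral_eq (μ.restrict (A ∩ H))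
      fun x => ENNReal.ofReal (J x)
    have hae : ∀ᵐ x ∂μ.restrict H, g x ≤ ENNReal.ofReal (p x) := by
      refine restrict_toMeasurable_ae_of_forall_mem
        (measurableSet_le hg hp.ennreal_ofReal) fun x hx => ?_
      rw [hpJ hx]
      exact hgJ x
    calc ∫⁻ x in A ∩ H, ENNReal.ofReal (J x) ∂μ = ∫⁻ x in A ∩ H, g x ∂μ := hgeq
      _ ≤ ∫⁻ x in A ∩ H, ENNReal.ofReal (p x) ∂μ :=
        lintegral_mono_ae (ae_mono (Measure.restrict_mono_set μ inter_subset_right) hae)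
      _ ≤ ∫⁻ x in A, ENNReal.ofReal (p x) ∂μ := lintegral_mono_set inter_subset_left
  eq_setLIntegral B hB hBC := by
    rw [hRN B hB]
    exact setLIntegral_congr_fun hB fun x hx => by rw [hpJ (hBC hx)]

theorem IsImageDensity.comp {X : Type*} [MeasurableSpace X] {μ : Measure X} [SFinite μ]
    {S T : X → X} {C V : Set X} {p q r : X → ℝ} (hp : IsImageDensity μ S C p)
    (hq : IsImageDensity μ T V q) (hS : Measurable S) (hC : MeasurableSet C)
    (hinj : InjOn S C) (hr : Measurable r)
    (hrpq : ∀ y ∈ C ∩ T '' V, r (S y) = p (S y) * q y) :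
    IsImageDensity μ (S ∘ T) (V ∩ T ⁻¹' C) r := by
  set P : X → ENNReal := fun x => ENNReal.ofReal (p x) with hP
  set R : X → ENNReal := fun x => ENNReal.ofReal (r x) with hR
  have hPm : Measurable P := hp.measurable.ennreal_ofReal
  have hRm : Measurable R := hr.ennreal_ofReal
  have hRP : Measurable fun x => R x / P x := hRm.div hPm
  have hqRP : ∀ y ∈ C ∩ T '' V, ENNReal.ofReal (q y) = R (S y) / P (S y) := by
    intro y hy
    have hpos := hp.pos (S y) (mem_image_of_mem S hy.1)
    rw [hR, hP]
    simp only [hrpq y hy]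
    rw [ENNReal.ofReal_mul hpos.le, mul_comm, ENNReal.mul_div_cancel_right
      (by simpa using hpos) ENNReal.ofReal_ne_top]
  have hset : ∀ A, (V ∩ T ⁻¹' C) ∩ (S ∘ T) ⁻¹' A = V ∩ T ⁻¹' (C ∩ S ⁻¹' A) := by
    intro A; ext x; simp [and_assoc]
  have hpush : ∀ A, MeasurableSet A → ∫⁻ y in C ∩ S ⁻¹' A, R (S y) / P (S y) ∂μ =
      ∫⁻ x in A, R x / P x ∂(μ.restrict C).map S := by
    intro A hA
    rw [setLIntegral_map hA hRP hS, Measure.restrict_restrict (hS hA), inter_comm]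
  have happly : ∀ A, MeasurableSet A → (μ.restrict C).map S A = μ (C ∩ S ⁻¹' A) := by
    intro A hA
    rw [Measure.map_apply hS hA, Measure.restrict_apply (hS hA), inter_comm]
  refine ⟨hr, ?_, ?_, ?_⟩
  · rintro _ ⟨x, ⟨hxV, hxC⟩, rfl⟩
    have hy : T x ∈ C ∩ T '' V := ⟨hxC, mem_image_of_mem T hxV⟩
    simp only [Function.comp_apply, hrpq _ hy]
    exact mul_pos (hp.pos _ (mem_image_of_mem S hxC)) (hq.pos _ hy.2)
  · intro A hA
    have hmeas : MeasurableSet (C ∩ S ⁻¹' A) := hC.inter (hS hA)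
    set H := toMeasurable μ (T '' V) with hH
    have hHm : MeasurableSet H := measurableSet_toMeasurable _ _
    have hcap : V ∩ T ⁻¹' (C ∩ S ⁻¹' A) = V ∩ T ⁻¹' (C ∩ S ⁻¹' A ∩ H) := by
      ext x
      simp only [mem_inter_iff, mem_preimage]
      exact ⟨fun h => ⟨h.1, h.2, subset_toMeasurable _ _ ⟨x, h.1, rfl⟩⟩, fun h => ⟨h.1, h.2.1⟩⟩
    have hae : ∀ᵐ y ∂μ.restrict H, y ∈ C → ENNReal.ofReal (q y) = R (S y) / P (S y) := by
      refine restrict_toMeasurable_ae_of_forall_mem ?_ fun y hy hyC => hqRP y ⟨hyC, hy⟩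
      exact MeasurableSet.imp hC
        (measurableSet_eq_fun hq.measurable.ennreal_ofReal (hRP.comp hS))
    have hle : (μ.restrict C).map S ≤ μ.withDensity P := by
      refine Measure.le_iff.2 fun B hB => ?_
      rw [happly B hB, withDensity_apply _ hB]
      exact hp.le_setLIntegral B hB
    rw [hset, hcap]
    calc μ (V ∩ T ⁻¹' (C ∩ S ⁻¹' A ∩ H))
        ≤ ∫⁻ y in C ∩ S ⁻¹' A ∩ H, ENNReal.ofReal (q y) ∂μ :=
          hq.le_setLIntegral _ (hmeas.inter hHm)
      _ = ∫⁻ y in C ∩ S ⁻¹' A ∩ H, R (S y) / P (S y) ∂μ := by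
          refine lintegral_congr_ae ?_
          filter_upwards [ae_mono (Measure.restrict_mono_set μ inter_subset_right) hae,
            ae_restrict_mem (hmeas.inter hHm)] with y hy hyC
          exact hy hyC.1.1
      _ ≤ ∫⁻ y in C ∩ S ⁻¹' A, R (S y) / P (S y) ∂μ := lintegral_mono_set inter_subset_left
      _ = ∫⁻ x in A, R x / P x ∂(μ.restrict C).map S := hpush A hA
      _ ≤ ∫⁻ x in A, R x / P x ∂μ.withDensity P :=
          lintegral_mono' (Measure.restrict_mono_measure hle A) le_rfl
      _ = ∫⁻ x in A, P x * (R x / P x) ∂μ := by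
          rw [restrict_withDensity hA, lintegral_withDensity_eq_lintegral_mul _ hPm hRP]
          rfl
      _ ≤ ∫⁻ x in A, R x ∂μ := lintegral_mono fun x => ENNReal.mul_div_le
  · intro B hB hBE
    have hBS : B ⊆ S '' C := by
      intro z hz
      obtain ⟨x, hx, rfl⟩ := hBE hz
      exact mem_image_of_mem S hx.2
    have hsub : C ∩ S ⁻¹' B ⊆ C ∩ T '' V := by
      rintro y ⟨hyC, hyB⟩
      obtain ⟨x, hx, hxy⟩ := hBE hyB
      exact ⟨hyC, x, hx.1, hinj hx.2 hyC hxy⟩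
    have hmeas : MeasurableSet (C ∩ S ⁻¹' B) := hC.inter (hS hB)
    have heq : ((μ.restrict C).map S).restrict B = (μ.restrict B).withDensity P := by
      refine Measure.ext fun A hA => ?_
      rw [Measure.restrict_apply hA, happly _ (hA.inter hB), withDensity_apply _ hA,
        Measure.restrict_restrict hA]
      exact hp.eq_setLIntegral _ (hA.inter hB) (inter_subset_right.trans hBS)
    rw [hset]
    calc μ (V ∩ T ⁻¹' (C ∩ S ⁻¹' B))
        = ∫⁻ y in C ∩ S ⁻¹' B, ENNReal.ofReal (q y) ∂μ :=
          hq.eq_setLIntegral _ hmeas (hsub.trans inter_subset_right)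
      _ = ∫⁻ y in C ∩ S ⁻¹' B, R (S y) / P (S y) ∂μ :=
          setLIntegral_congr_fun hmeas fun y hy => hqRP y (hsub hy)
      _ = ∫⁻ x in B, R x / P x ∂(μ.restrict C).map S := hpush B hB
      _ = ∫⁻ x in B, P x * (R x / P x) ∂μ := by
          rw [heq, lintegral_withDensity_eq_lintegral_mul _ hPm hRP]
          rfl
      _ = ∫⁻ x in B, R x ∂μ := by
          refine setLIntegral_congr_fun hB fun x hx => ?_
          exact ENNReal.mul_div_cancel (by simpa [hP] using hp.pos x (hBS hx))
            ENNReal.ofReal_ne_top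

/-- An image density can be modified off the image `S '' C` so as to become a version of the
Radon–Nikodym derivative of the pushforward. -/
theorem IsImageDensity.exists_eqOn_forall_setLIntegral_eq {X : Type*} [MeasurableSpace X]
    {μ : Measure X} [SigmaFinite μ] {S : X → X} {C : Set X} {p : X → ℝ}
    (hp : IsImageDensity μ S C p) (hS : Measurable S) :
    ∃ J : X → ℝ, EqOn J p (S '' C) ∧ ∀ A, MeasurableSet A →
      μ (C ∩ S ⁻¹' A) = ∫⁻ x in A, ENNReal.ofReal (J x) ∂μ := by
  classical
  set P : X → ENNReal := fun x => ENNReal.ofReal (p x) with hP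
  have hPm : Measurable P := hp.measurable.ennreal_ofReal
  set ν := (μ.restrict C).map S with hν
  have happly : ∀ A, MeasurableSet A → ν A = μ (C ∩ S ⁻¹' A) := by
    intro A hA
    rw [Measure.map_apply hS hA, Measure.restrict_apply (hS hA), inter_comm]
  have hle : ∀ A, MeasurableSet A → ν A ≤ ∫⁻ x in A, P x ∂μ := fun A hA => by
    rw [happly A hA]; exact hp.le_setLIntegral A hA
  have hac : ν ≪ μ := Measure.AbsolutelyContinuous.mk fun A hA h0 => by
    simpa [setLIntegral_measure_zero A P h0] using hle A hA
  have hνd : μ.withDensity (ν.rnDeriv μ) = ν := Measure.withDensity_rnDeriv_eq ν μ hac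
  have hrn : ∀ A, MeasurableSet A → ∫⁻ x in A, ν.rnDeriv μ x ∂μ = ν A := fun A hA => by
    rw [← withDensity_apply _ hA, hνd]
  have hae : ν.rnDeriv μ ≤ᵐ[μ] P :=
    ae_le_of_forall_setLIntegral_le_of_sigmaFinite (Measure.measurable_rnDeriv ν μ)
      fun A hA _ => (hrn A hA).trans_le (hle A hA)
  set g : X → ENNReal := fun x => min (ν.rnDeriv μ x) (P x) with hg
  have hgm : Measurable g := (Measure.measurable_rnDeriv ν μ).min hPm
  have hgint : ∀ A, MeasurableSet A → ∫⁻ x in A, g x ∂μ = ν A := fun A hA => by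
    rw [← hrn A hA]
    refine lintegral_congr_ae (ae_restrict_of_ae ?_)
    filter_upwards [hae] with x hx
    exact min_eq_left hx
  have hgtop : ∀ x, g x ≠ ⊤ := fun x =>
    ne_top_of_le_ne_top ENNReal.ofReal_ne_top (min_le_right _ _)
  set J : X → ℝ := fun x => if x ∈ S '' C then p x else (g x).toReal with hJ
  have hJin : ∀ x ∈ S '' C, J x = p x := fun x hx => if_pos hx
  have hJout : ∀ x ∉ S '' C, ENNReal.ofReal (J x) = g x := fun x hx => by
    simp only [hJ, if_neg hx, ENNReal.ofReal_toReal (hgtop x)]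
  refine ⟨J, hJin, fun A hA => ?_⟩
  rw [← happly A hA]
  apply le_antisymm
  · rw [← hgint A hA]
    refine lintegral_mono fun x => ?_
    by_cases hx : x ∈ S '' C
    · rw [hJin x hx]; exact min_le_right _ _
    · rw [hJout x hx]
  · obtain ⟨h, hhm, hhJ, hheq⟩ := exists_measurable_le_lintegral_eq (μ.restrict A)
      fun x => ENNReal.ofReal (J x)
    have hB : MeasurableSet {x | h x ≤ g x} := measurableSet_le hhm hgm
    have hBim : A \ {x | h x ≤ g x} ⊆ S '' C := by
      rintro x ⟨-, hx⟩
      by_contra hxC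
      exact hx ((hhJ x).trans_eq (hJout x hxC))
    have hin : ∫⁻ x in A ∩ {x | h x ≤ g x}, h x ∂μ ≤ ν (A ∩ {x | h x ≤ g x}) := by
      rw [← hgint _ (hA.inter hB)]
      exact setLIntegral_mono hgm fun x hx => hx.2
    have hout : ∫⁻ x in A \ {x | h x ≤ g x}, h x ∂μ ≤ ν (A \ {x | h x ≤ g x}) := by
      rw [happly _ (hA.diff hB), hp.eq_setLIntegral _ (hA.diff hB) hBim]
      refine setLIntegral_mono hPm fun x hx => (hhJ x).trans_eq ?_
      simp only [hJin x (hBim hx)]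
    rw [hheq, ← lintegral_inter_add_sdiff h A hB, ← measure_inter_add_sdiff A hB]
    exact add_le_add hin hout

theorem iInter_preimage_iterate_succ {X ι : Type*} (T : X → X) (O : ι → Set X) (n : ℕ)
    (w : Fin (n + 1) → ι) :
    (⋂ k : Fin (n + 1), (T^[(k : ℕ)]) ⁻¹' O (w k)) =
      O (w 0) ∩ T ⁻¹' ⋂ k : Fin n, (T^[(k : ℕ)]) ⁻¹' O (w k.succ) := by
  ext x
  simp [Fin.forall_fin_succ]

/-- Points of a common cylinder are contracted by the inverse branch of `T^[n]`. -/
theorem dist_le_pow_mul_dist_iterate {X ι : Type*} [MetricSpace X] {T : X → X} {O : ι → Set X}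
    {ε s : ℝ} (hs : 0 ≤ s) (hs1 : s ≤ 1)
    (hH1 : ∀ i, ∀ x ∈ O i, ∀ y ∈ O i, dist (T x) (T y) ≤ ε → dist x y ≤ s * dist (T x) (T y))
    (n : ℕ) (w : Fin n → ι) {x y : X} (hx : x ∈ ⋂ k : Fin n, (T^[(k : ℕ)]) ⁻¹' O (w k))
    (hy : y ∈ ⋂ k : Fin n, (T^[(k : ℕ)]) ⁻¹' O (w k)) (hxy : dist (T^[n] x) (T^[n] y) ≤ ε) :
    dist x y ≤ s ^ n * dist (T^[n] x) (T^[n] y) := by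
  induction n generalizing x y with
  | zero => simp
  | succ n ih =>
    rw [iInter_preimage_iterate_succ] at hx hy
    simp only [Function.iterate_succ_apply] at hxy ⊢
    have htail := ih (fun k => w k.succ) hx.2 hy.2 hxy
    have hsmall : s ^ n * dist (T^[n] (T x)) (T^[n] (T y)) ≤ dist (T^[n] (T x)) (T^[n] (T y)) :=
      mul_le_of_le_one_left dist_nonneg (pow_le_one₀ hs hs1)
    calc dist x y ≤ s * dist (T x) (T y) :=
          hH1 _ x hx.1 y hy.1 (htail.trans (hsmall.trans hxy))
      _ ≤ s * (s ^ n * dist (T^[n] (T x)) (T^[n] (T y))) := by gcongr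
      _ = s ^ (n + 1) * dist (T^[n] (T x)) (T^[n] (T y)) := by ring

theorem exists_isImageDensity_iterate {X : Type*} [MetricSpace X] [MeasurableSpace X]
    [BorelSpace X] {μ : Measure X} [SFinite μ] {T : X → X} (hT : Measurable T)
    {ι : Type*} {O : ι → Set X} (hO : ∀ i, MeasurableSet (O i)) {q : ι → X → ℝ}
    (hq : ∀ i, IsImageDensity μ T (O i) (q i)) {ε₂ s α D ε₃ : ℝ} (hε₂ : 0 < ε₂) (hs : 0 < s)
    (hs1 : s < 1)
    (hH1 : ∀ i, ∀ x ∈ O i, ∀ y ∈ O i, dist (T x) (T y) ≤ ε₂ →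
      dist x y ≤ s * dist (T x) (T y))
    (hα : 0 < α) (hD : 0 ≤ D) (hε₃ : 0 < ε₃)
    (hH2 : ∀ i, DistortionBoundOn (T '' O i) D α ε₃ (q i)) (n : ℕ) (w : Fin n → ι) :
    ∃ p : X → ℝ, IsImageDensity μ T^[n] (⋂ k : Fin n, (T^[(k : ℕ)]) ⁻¹' O (w k)) p ∧
      DistortionBoundOn (T^[n] '' ⋂ k : Fin n, (T^[(k : ℕ)]) ⁻¹' O (w k))
        (D * ∑ k ∈ Finset.range n, (s ^ α) ^ k) α (min ε₂ ε₃) p := by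
  induction n with
  | zero =>
    refine ⟨fun _ => 1, ⟨measurable_const, fun _ _ => one_pos, ?_, ?_⟩, ?_⟩
    · intro A _; simp
    · intro B _ _; simp
    · intro u _ v _ _; simp
  | succ n ih =>
    obtain ⟨p, hp, hpd⟩ := ih fun k => w k.succ
    set C := ⋂ k : Fin n, (T^[(k : ℕ)]) ⁻¹' O (w k.succ) with hC
    have hCm : MeasurableSet C := MeasurableSet.iInter fun k => hT.iterate _ (hO _)
    have hcontr : ∀ x ∈ C, ∀ y ∈ C, dist (T^[n] x) (T^[n] y) ≤ ε₂ →
        dist x y ≤ s ^ n * dist (T^[n] x) (T^[n] y) := fun x hx y hy =>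
      dist_le_pow_mul_dist_iterate hs.le hs1.le hH1 n _ hx hy
    have hinj : InjOn T^[n] C := by
      intro x hx y hy hxy
      have h := hcontr x hx y hy (by rw [hxy, dist_self]; exact hε₂.le)
      rw [hxy, dist_self, mul_zero] at h
      exact dist_le_zero.1 h
    rw [iInter_preimage_iterate_succ, ← hC, Function.iterate_succ]
    set V := O (w 0) with hV
    set φ : X → ℝ := fun z => p z * Function.extend (fun y : C => T^[n] y)
      (fun y : C => q (w 0) y) 0 z with hφ
    have hφS : ∀ y ∈ C, φ (T^[n] y) = p (T^[n] y) * q (w 0) y := by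
      intro y hy
      have hi : Function.Injective fun y : C => T^[n] (y : X) :=
        fun a b hab => Subtype.ext (hinj a.2 b.2 hab)
      exact congrArg (p (T^[n] y) * ·)
        (hi.extend_apply (fun y : C => q (w 0) (y : X)) 0 ⟨y, hy⟩)
    have hφd : DistortionBoundOn ((T^[n] ∘ T) '' (V ∩ T ⁻¹' C))
        (D * ∑ k ∈ Finset.range (n + 1), (s ^ α) ^ k) α (min ε₂ ε₃) φ := by
      rintro _ ⟨x, ⟨hxV, hxC⟩, rfl⟩ _ ⟨y, ⟨hyV, hyC⟩, rfl⟩ hxy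
      simp only [Function.comp_apply, mem_preimage] at hxC hyC hxy ⊢
      set d := dist (T^[n] (T x)) (T^[n] (T y)) with hd
      have hd0 : 0 ≤ d := dist_nonneg
      have hc : dist (T x) (T y) ≤ s ^ n * d := hcontr _ hxC _ hyC (hxy.trans (min_le_left _ _))
      have hsn : s ^ n * d ≤ d := mul_le_of_le_one_left hd0 (pow_le_one₀ hs.le hs1.le)
      have hpow : dist (T x) (T y) ^ α ≤ (s ^ α) ^ n * d ^ α := by
        calc dist (T x) (T y) ^ α ≤ (s ^ n * d) ^ α :=
              Real.rpow_le_rpow dist_nonneg hc hα.le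
          _ = (s ^ α) ^ n * d ^ α := by
              rw [Real.mul_rpow (by positivity) hd0, ← Real.rpow_natCast_mul hs.le,
                ← Real.rpow_mul_natCast hs.le, mul_comm (n : ℝ) α]
      have h1 := hpd _ (mem_image_of_mem _ hxC) _ (mem_image_of_mem _ hyC) hxy
      have h2 := hH2 (w 0) _ (mem_image_of_mem T hxV) _ (mem_image_of_mem T hyV)
        (hc.trans (hsn.trans (hxy.trans (min_le_right _ _))))
      have hq0 : 0 < q (w 0) (T y) := (hq (w 0)).pos _ (mem_image_of_mem T hyV)
      have hqx : 0 < q (w 0) (T x) := (hq (w 0)).pos _ (mem_image_of_mem T hxV)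
      have hp0 : 0 < p (T^[n] (T y)) := hp.pos _ (mem_image_of_mem _ hyC)
      have h3 : q (w 0) (T x) ≤ Real.exp (D * ((s ^ α) ^ n * d ^ α)) * q (w 0) (T y) :=
        h2.trans (by gcongr)
      rw [hφS _ hxC, hφS _ hyC]
      calc p (T^[n] (T x)) * q (w 0) (T x)
          ≤ (Real.exp ((D * ∑ k ∈ Finset.range n, (s ^ α) ^ k) * d ^ α) * p (T^[n] (T y))) *
            (Real.exp (D * ((s ^ α) ^ n * d ^ α)) * q (w 0) (T y)) :=
            mul_le_mul h1 h3 hqx.le (by positivity)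
        _ = Real.exp ((D * ∑ k ∈ Finset.range (n + 1), (s ^ α) ^ k) * d ^ α) *
            (p (T^[n] (T y)) * q (w 0) (T y)) := by
            rw [Finset.sum_range_succ, mul_add, add_mul, Real.exp_add, mul_assoc D ((s ^ α) ^ n)]
            ring
    obtain ⟨r, hr, hrφ⟩ :=
      (hφd.continuousOn hα (lt_min hε₂ hε₃)).exists_measurable_eqOn
    refine ⟨r, hp.comp (hq (w 0)) (hT.iterate n) hCm hinj hr ?_, hφd.congr hrφ⟩
    rintro _ ⟨hyC, x, hxV, rfl⟩
    rw [← hφS _ hyC]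
    exact hrφ ⟨x, ⟨hxV, hyC⟩, rfl⟩

/-- Uniform distortion bound for all iterates.  In the piecewise invertible
setting, under the uniform expansion hypothesis (H1) and the one-step bounded distortion
hypothesis (H2), for every `n ≥ 1` and every cylinder `O ∈ Pⁿ` (given by a word
`w : Fin n → ι`) there is a version `Jn` of the Radon–Nikodym derivative of the pushforward
of `μ` restricted to `O` under `T^n` such that
`Jn(u) ≤ e^{D·d(u,v)^α}·Jn(v)` for all `u,v ∈ T^n(O)` with `d(u,v) ≤ min{ε₂,ε₃}`, where
`D = D̃/(1−s^α)`. -/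
theorem uniform_distortion_of_iterates {X : Type*} [MetricSpace X] [MeasurableSpace X]
    [BorelSpace X] (μ : Measure X) [SigmaFinite μ] (T : X → X) (hT : Measurable T)
    {ι : Type*} [Countable ι] (O : ι → Set X)
    (hOopen : ∀ i, IsOpen (O i)) (hOne : ∀ i, (O i).Nonempty)
    (hOdisj : Pairwise (Function.onFun Disjoint O))
    (hcover : μ (univ \ ⋃ i, O i) = 0)
    (hhomeo : ∀ i, ∃ e : (O i) ≃ₜ (T '' O i), ∀ x : O i, (e x : X) = T x)
    (J : ι → X → ℝ)
    (hJpos : ∀ i, ∀ x ∈ T '' O i, 0 < J i x)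
    (hJRN : ∀ i, ∀ A : Set X, MeasurableSet A →
      μ (O i ∩ T ⁻¹' A) = ∫⁻ x in A, ENNReal.ofReal (J i x) ∂μ)
    (ε₂ s : ℝ) (hε₂ : 0 < ε₂) (hs : 0 < s) (hs1 : s < 1)
    (hH1 : ∀ i, ∀ x ∈ O i, ∀ y ∈ O i, dist (T x) (T y) ≤ ε₂ →
      dist x y ≤ s * dist (T x) (T y))
    (α Dt ε₃ : ℝ) (hα : 0 < α) (hα1 : α ≤ 1) (hDt : 0 ≤ Dt) (hε₃ : 0 < ε₃)
    (hH2 : ∀ i, ∀ u ∈ T '' O i, ∀ v ∈ T '' O i, dist u v ≤ ε₃ →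
      J i u ≤ Real.exp (Dt * dist u v ^ α) * J i v) :
    ∀ n : ℕ, 1 ≤ n → ∀ w : Fin n → ι,
      ∃ Jn : X → ℝ,
        (∀ A : Set X, MeasurableSet A →
          μ ((⋂ k : Fin n, (T^[(k : ℕ)]) ⁻¹' O (w k)) ∩ (T^[n]) ⁻¹' A) =
            ∫⁻ x in A, ENNReal.ofReal (Jn x) ∂μ) ∧
        ∀ u ∈ (T^[n]) '' ⋂ k : Fin n, (T^[(k : ℕ)]) ⁻¹' O (w k),
          ∀ v ∈ (T^[n]) '' ⋂ k : Fin n, (T^[(k : ℕ)]) ⁻¹' O (w k),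
            dist u v ≤ min ε₂ ε₃ →
            Jn u ≤ Real.exp ((Dt / (1 - s ^ α)) * dist u v ^ α) * Jn v := by
  have hex : ∀ i, ∃ q : X → ℝ, IsImageDensity μ T (O i) q ∧
      DistortionBoundOn (T '' O i) Dt α ε₃ q := by
    intro i
    have hd : DistortionBoundOn (T '' O i) Dt α ε₃ (J i) := hH2 i
    obtain ⟨q, hq, hqJ⟩ := (hd.continuousOn hα hε₃).exists_measurable_eqOn
    exact ⟨q, .of_forall_setLIntegral_eq hq hqJ (hJpos i) (hJRN i), hd.congr hqJ⟩
  choose q hq hqd using hex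
  intro n _ w
  obtain ⟨p, hp, hpd⟩ := exists_isImageDensity_iterate hT (fun i => (hOopen i).measurableSet) hq
    hε₂ hs hs1 hH1 hα hDt hε₃ hqd n w
  obtain ⟨Jn, hJn, hJnRN⟩ := hp.exists_eqOn_forall_setLIntegral_eq (hT.iterate n)
  refine ⟨Jn, hJnRN, fun u hu v hv huv => (hpd.congr hJn u hu v hv huv).trans ?_⟩
  have hsα : s ^ α < 1 := Real.rpow_lt_one hs.le hs1 hα
  have hsα0 : 0 ≤ s ^ α := Real.rpow_nonneg hs.le α
  have hsum : ∑ k ∈ Finset.range n, (s ^ α) ^ k ≤ 1 / (1 - s ^ α) := by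
    rw [one_div, ← tsum_geometric_of_lt_one hsα0 hsα]
    exact (summable_geometric_of_lt_one hsα0 hsα).sum_le_tsum _ fun k _ => pow_nonneg hsα0 k
  have hJv : 0 < Jn v := by rw [hJn hv]; exact hp.pos v hv
  rw [div_eq_mul_one_div Dt]
  gcongr
end

section
/- Regularity of the remainder after subtracting a constant (key step of the splitting lemma). Let (X,d) be a metric space, α ∈ (0,1], a ≥ 0, I ⊆ X, and let ρ : I → ℝ satisfy |ln ρ(x) − ln ρ(y)| ≤ a·d(x,y)^α for all x,y ∈ I (in particular ρ > 0). Suppose c > 0 satisfies ρ(x) ≥ 2c for every x ∈ I. Then the function ρ − c is positive on I and satisfies |ln(ρ(x)−c) − ln(ρ(y)−c)| ≤ 2a·d(x,y)^α for all x,y ∈ I. -/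
/-- For `u, v ≥ 2c`, the increment of `log (· - c)` is at most twice that of `log`. -/
theorem log_sub_const_sub_log_sub_const_le {c u v : ℝ} (hc : 0 < c) (hu : 2 * c ≤ u)
    (hv : 2 * c ≤ v) :
    Real.log (u - c) - Real.log (v - c) ≤ 2 * |Real.log u - Real.log v| := by
  have hu0 : 0 < u := by linarith
  have hv0 : 0 < v := by linarith
  have huc : 0 < u - c := by linarith
  have hvc : 0 < v - c := by linarith
  rcases le_total u v with huv | hvu
  · have hlog := Real.log_le_log huc (sub_le_sub_right huv c)
    linarith [abs_nonneg (Real.log u - Real.log v)]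
  · have hmul : (u - c) * v ^ 2 ≤ u ^ 2 * (v - c) := by
      have hfactor : 0 ≤ u * v - c * (u + v) := by nlinarith
      nlinarith [mul_nonneg (sub_nonneg.2 hvu) hfactor]
    have hlog := Real.log_le_log (by positivity) hmul
    rw [Real.log_mul huc.ne' (by positivity), Real.log_mul (by positivity) hvc.ne',
      Real.log_pow, Real.log_pow] at hlog
    push_cast at hlog
    linarith [le_abs_self (Real.log u - Real.log v)]

/-- Regularity of the remainder after subtracting a constant.
If `ρ` satisfies the log-Hölder bound `H_α(ρ) ≤ a` on `I` and `ρ ≥ 2c` on `I` with `c > 0`,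
then `ρ - c` is positive on `I` and satisfies `H_α(ρ - c) ≤ 2a`. -/
theorem remainder_regularity {X : Type*} [MetricSpace X] (α a : ℝ)
    (hα : 0 < α) (hα1 : α ≤ 1) (ha : 0 ≤ a) (I : Set X) (ρ : X → ℝ)
    (hH : ∀ x ∈ I, ∀ y ∈ I, |Real.log (ρ x) - Real.log (ρ y)| ≤ a * dist x y ^ α)
    (c : ℝ) (hc : 0 < c) (hρc : ∀ x ∈ I, 2 * c ≤ ρ x) :
    (∀ x ∈ I, 0 < ρ x - c) ∧
      ∀ x ∈ I, ∀ y ∈ I,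
        |Real.log (ρ x - c) - Real.log (ρ y - c)| ≤ 2 * a * dist x y ^ α := by
  refine ⟨fun x hx => by linarith [hρc x hx], fun x hx y hy => ?_⟩
  have hxy := log_sub_const_sub_log_sub_const_le hc (hρc x hx) (hρc y hy)
  have hyx := log_sub_const_sub_log_sub_const_le hc (hρc y hy) (hρc x hx)
  rw [abs_sub_comm (Real.log (ρ y))] at hyx
  have hbound := hH x hx y hy
  exact abs_le.2 ⟨by linarith, by linarith⟩
end

section
/- Action of an extendable inverse branch on ε-boundaries. Let (X,d) be a metric space, let O ⊆ X, and let T̄ : cl(O) → X be a map with V := T̄(O) such that T̄ is a bijection from cl(O) onto cl(V); denote its inverse by h̄. Assume there exist ε₂ > 0 and s ∈ (0,1) such that d(h̄(u), h̄(v)) ≤ s·d(u,v) for all u,v ∈ cl(V) with d(u,v) ≤ ε₂, and assume ∂V ⊆ T̄(∂O). Then for every subset A ⊆ O and every ε ∈ (0, ε₂]: {x ∈ A : dist(T̄x, ∂(T̄(A))) < ε} ⊆ {x ∈ A : dist(x, ∂A) < s·ε} = ∂_{sε}A. -/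
/-- The `ε`-boundary layer `∂_ε A = {x ∈ A : dist(x, ∂A) < ε}`, with the convention
`dist(x, ∅) = ∞` encoded via `EMetric.infEdist`. -/
def bdryLayer {X : Type*} [MetricSpace X] (ε : ℝ) (A : Set X) : Set X :=
  {x ∈ A | EMetric.infEdist x (frontier A) < ENNReal.ofReal ε}

/-- A map that expands distances up to the scale `r` by at most the factor `K` is continuous. -/
theorem continuousOn_of_dist_le_mul_of_dist_le {X Y : Type*} [PseudoMetricSpace X]
    [PseudoMetricSpace Y] {f : X → Y} {S : Set X} {r K : ℝ} (hr : 0 < r)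
    (h : ∀ u ∈ S, ∀ v ∈ S, dist u v ≤ r → dist (f u) (f v) ≤ K * dist u v) :
    ContinuousOn f S := by
  intro v hv
  refine tendsto_iff_dist_tendsto_zero.2 (squeeze_zero' (g := fun u => K * dist u v)
    (Filter.Eventually.of_forall fun _ => dist_nonneg) ?_ ?_)
  · filter_upwards [self_mem_nhdsWithin,
      mem_nhdsWithin_of_mem_nhds (Metric.ball_mem_nhds v hr)] with u hu huv
    exact h u hu v hv (Metric.mem_ball.1 huv).le
  · have hc : Continuous fun u => K * dist u v := by fun_prop
    simpa using (hc.tendsto v).mono_left (nhdsWithin_le_nhds (s := S))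

/-- A continuous inverse `g` of `f` maps boundary points of `f '' A` to boundary points of `A`. -/
theorem mapsTo_frontier_image_of_leftInvOn {X Y : Type*} [TopologicalSpace X] [TopologicalSpace Y]
    {f : X → Y} {g : Y → X} {O A : Set X} (hgf : Set.LeftInvOn g f (closure O))
    (hg : ContinuousOn g (closure (f '' O)))
    (hfront : frontier (f '' O) ⊆ f '' frontier O) (hAO : A ⊆ O) :
    Set.MapsTo g (frontier (f '' A)) (frontier A) := by
  intro v hv
  rw [frontier_eq_closure_inter_closure] at hv ⊢
  have hvV : v ∈ closure (f '' O) := closure_mono (Set.image_mono hAO) hv.1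
  have hcont : ∀ S ⊆ f '' O, ContinuousWithinAt g S v :=
    fun S hS => (hg v hvV).mono (hS.trans subset_closure)
  refine ⟨(hcont _ (Set.image_mono hAO)).mem_closure hv.1 ?_, ?_⟩
  · rintro _ ⟨a, ha, rfl⟩
    rwa [hgf (subset_closure (hAO ha))]
  have hcover : (f '' A)ᶜ ⊆ (f '' O)ᶜ ∪ f '' O \ f '' A := by
    intro w hw
    by_cases hwO : w ∈ f '' O
    · exact Or.inr ⟨hwO, hw⟩
    · exact Or.inl hwO
  have hv' := closure_mono hcover hv.2
  rw [closure_union] at hv'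
  rcases hv' with hv' | hv'
  · have hvf : v ∈ frontier (f '' O) := by
      rw [frontier_eq_closure_inter_closure]
      exact ⟨hvV, hv'⟩
    obtain ⟨y, hy, rfl⟩ := hfront hvf
    rw [hgf (frontier_subset_closure hy)]
    rw [frontier_eq_closure_inter_closure] at hy
    exact closure_mono (Set.compl_subset_compl.2 hAO) hy.2
  · refine (hcont _ Set.sdiff_subset).mem_closure hv' ?_
    rintro _ ⟨⟨o, ho, rfl⟩, hoA⟩
    rw [hgf (subset_closure ho)]
    exact fun ha => hoA ⟨o, ha, rfl⟩

/-- Action of an extendable inverse branch on `ε`-boundaries.  Let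
`T̄ : cl O → cl V` be a bijection (`V = T̄(O)`) with inverse `h̄` which contracts distances
`≤ ε₂` by the factor `s < 1`, and assume `∂V ⊆ T̄(∂O)`.  Then for every `A ⊆ O` and every
`ε ∈ (0, ε₂]`, `{x ∈ A : dist(T̄x, ∂(T̄A)) < ε} ⊆ ∂_{sε}A`. -/
theorem inverse_branch_boundary_action {X : Type*} [MetricSpace X]
    (O : Set X) (Tb hb : X → X) (V : Set X) (hV : V = Tb '' O)
    (hbij : Set.BijOn Tb (closure O) (closure V))
    (hinv : Set.InvOn hb Tb (closure O) (closure V))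
    (ε₂ s : ℝ) (hε₂ : 0 < ε₂) (hs : 0 < s) (hs1 : s < 1)
    (hlip : ∀ u ∈ closure V, ∀ v ∈ closure V, dist u v ≤ ε₂ →
      dist (hb u) (hb v) ≤ s * dist u v)
    (hfront : frontier V ⊆ Tb '' (frontier O)) :
    ∀ A : Set X, A ⊆ O → ∀ ε : ℝ, 0 < ε → ε ≤ ε₂ →
      {x ∈ A | EMetric.infEdist (Tb x) (frontier (Tb '' A)) < ENNReal.ofReal ε} ⊆
        bdryLayer (s * ε) A := by
  subst hV
  rintro A hAO ε - hε x ⟨hxA, hx⟩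
  refine ⟨hxA, ?_⟩
  obtain ⟨v, hv, hxv⟩ := Metric.infEDist_lt_iff.1 hx
  rw [edist_lt_ofReal] at hxv
  have hvV : v ∈ closure (Tb '' O) :=
    closure_mono (Set.image_mono hAO) (frontier_subset_closure hv)
  have hxO : x ∈ closure O := subset_closure (hAO hxA)
  have hhv : hb v ∈ frontier A := mapsTo_frontier_image_of_leftInvOn hinv.1
    (continuousOn_of_dist_le_mul_of_dist_le hε₂ hlip) hfront hAO hv
  refine Metric.infEDist_lt_iff.2 ⟨hb v, hhv, ?_⟩
  rw [edist_lt_ofReal]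
  calc dist x (hb v) = dist (hb (Tb x)) (hb v) := by rw [hinv.1 hxO]
    _ ≤ s * dist (Tb x) v := hlip _ (hbij.mapsTo hxO) _ hvV (hxv.le.trans hε)
    _ < s * ε := mul_lt_mul_of_pos_left hxv hs
end

section
/- Bounded distortion of the nonlinear branch of the W-map. Let T be the W-map. For all u, v ∈ (9/16, 1): |ln(2u + 81/112) − ln(2v + 81/112)| ≤ (25088/42849)·|T(u) − T(v)|. (Here 2x + 81/112 is the derivative of the branch T(x) = x² + (81/112)x − 81/112 on O₄ = (9/16,1); this verifies the log-Lipschitz distortion hypothesis for the inverse branch h₄ with constant D̃ = 25088/42849 and exponent α = 1, i.e. Jh₄(x) ≤ e^{(25088/42849)|x−y|}·Jh₄(y) for x,y in the image of O₄.) -/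
/-- The nonlinear W-map on `(0,1)` (values at the partition points are irrelevant). -/
noncomputable def Wmap (x : ℝ) : ℝ :=
  if x < 9 / 40 then 1 - (40 / 9) * x
  else if x < 9 / 20 then 2 * (x - 9 / 40)
  else if x < 9 / 16 then -4 * (x - 9 / 16)
  else x ^ 2 + (81 / 112) * x - 81 / 112

/-- If `0 < m ≤ b ≤ a`, then `log a - log b ≤ (a ^ 2 - b ^ 2) / (2 * m ^ 2)`. -/
theorem log_sub_log_le_sq_sub_sq_div {m a b : ℝ} (hm : 0 < m) (hmb : m ≤ b) (hba : b ≤ a) :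
    Real.log a - Real.log b ≤ (a ^ 2 - b ^ 2) / (2 * m ^ 2) := by
  have hb : 0 < b := hm.trans_le hmb
  have ha : 0 < a := hb.trans_le hba
  have hlog : Real.log ((a / b) ^ 2) ≤ (a / b) ^ 2 - 1 :=
    Real.log_le_sub_one_of_pos (by positivity)
  rw [Real.log_pow, Real.log_div ha.ne' hb.ne'] at hlog
  push_cast at hlog
  calc Real.log a - Real.log b ≤ ((a / b) ^ 2 - 1) / 2 := by linarith
    _ = (a ^ 2 - b ^ 2) / (2 * b ^ 2) := by field_simp
    _ ≤ (a ^ 2 - b ^ 2) / (2 * m ^ 2) := by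
      have : 0 ≤ a ^ 2 - b ^ 2 := sub_nonneg.2 (pow_le_pow_left₀ hb.le hba 2)
      gcongr

/-- On the last branch, the difference of values of `Wmap` in terms of the derivative. -/
theorem Wmap_sub_Wmap {u v : ℝ} (hu : 9 / 16 ≤ u) (hv : 9 / 16 ≤ v) :
    Wmap u - Wmap v = ((2 * u + 81 / 112) ^ 2 - (2 * v + 81 / 112) ^ 2) / 4 := by
  have hW : ∀ x : ℝ, 9 / 16 ≤ x → Wmap x = x ^ 2 + (81 / 112) * x - 81 / 112 := by
    intro x hx
    rw [Wmap, if_neg (by linarith), if_neg (by linarith), if_neg (by linarith)]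
  rw [hW u hu, hW v hv]
  ring

/-- Bounded distortion of the nonlinear branch of the W-map: for all
`u, v ∈ (9/16, 1)`,
`|ln(2u + 81/112) − ln(2v + 81/112)| ≤ (25088/42849)·|T(u) − T(v)|`,
where `2x + 81/112` is the derivative of the branch of `T` on `(9/16,1)`.  This is the
log-Lipschitz distortion bound for the inverse branch `h₄`, with `D̃ = 25088/42849` and
`α = 1`. -/
theorem Wmap_nonlinear_branch_distortion :
    ∀ u ∈ Set.Ioo ((9 : ℝ) / 16) 1, ∀ v ∈ Set.Ioo ((9 : ℝ) / 16) 1,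
      |Real.log (2 * u + 81 / 112) - Real.log (2 * v + 81 / 112)| ≤
        (25088 / 42849) * |Wmap u - Wmap v| := by
  intro u hu v hv
  wlog huv : v ≤ u generalizing u v
  · rw [abs_sub_comm, abs_sub_comm (Wmap u)]
    exact this v hv u hu (le_of_not_ge huv)
  have hv' := hv.1
  have hlog := log_sub_log_le_sq_sub_sq_div (m := 207 / 112) (a := 2 * u + 81 / 112)
    (b := 2 * v + 81 / 112) (by norm_num) (by linarith) (by linarith)
  rw [abs_of_nonneg (sub_nonneg.2 (Real.log_le_log (by linarith) (by linarith)))]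
  refine hlog.trans (le_trans (le_of_eq ?_)
    (mul_le_mul_of_nonneg_left (le_abs_self _) (by norm_num)))
  rw [Wmap_sub_Wmap hu.1.le hv.1.le]
  ring
end

section
/- Dynamical complexity bound for the W-map. Let T be the W-map with partition intervals O₁, O₂, O₃, O₄ and set s = 112/207. Then for every nonempty open interval I ⊆ (0,1) with Leb(I) ≤ 1/4 and every ε ∈ (0, 1/4): Σ_{j=1}^{4} Leb({x ∈ I ∩ O_j : dist(T x, ∂(T(I ∩ O_j))) < ε} ∖ ∂_{sε}I) ≤ (621/896)·Leb(∂_{sε}I). (This verifies the complexity hypothesis (H3) for the W-map with n₀ = 1 and σ = 621/896, which is strictly less than s^{−1} − 1 = 95/112.) -/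
open MeasureTheory

/-- The four partition intervals of the W-map. -/
def WO : Fin 4 → Set ℝ :=
  ![Set.Ioo 0 (9 / 40), Set.Ioo (9 / 40) (9 / 20), Set.Ioo (9 / 20) (9 / 16),
    Set.Ioo (9 / 16) 1]

/-- The topological boundary of `A` relative to the ambient space `(0,1)`:
`cl_{(0,1)}(A) ∩ cl_{(0,1)}((0,1)∖A)`. -/
def relBdry (A : Set ℝ) : Set ℝ :=
  closure A ∩ closure (Set.Ioo (0 : ℝ) 1 \ A) ∩ Set.Ioo (0 : ℝ) 1

/-- The `ε`-boundary layer `∂_ε A = {x ∈ A : dist(x, ∂A) < ε}` relative to `(0,1)`,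
with the convention `dist(x, ∅) = ∞` encoded via `EMetric.infEdist`. -/
def relLayer (ε : ℝ) (A : Set ℝ) : Set ℝ :=
  {x ∈ A | EMetric.infEdist x (relBdry A) < ENNReal.ofReal ε}

lemma relBdry_Ioo_subset {p q : ℝ} (h : p < q) :
    relBdry (Set.Ioo p q) ⊆ {p, q} ∩ Set.Ioo 0 1 := by
  rintro y ⟨⟨hy, hy'⟩, hy01⟩
  refine ⟨?_, hy01⟩
  rw [← frontier_Ioo h, frontier_eq_closure_inter_closure]
  exact ⟨hy, closure_mono (fun z hz => hz.2) hy'⟩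

lemma mem_relBdry_Ioo {a b z : ℝ} (h : a < b) (hz : z = a ∨ z = b)
    (hz01 : z ∈ Set.Ioo (0 : ℝ) 1) : z ∈ relBdry (Set.Ioo a b) := by
  refine ⟨⟨?_, subset_closure ⟨hz01, ?_⟩⟩, hz01⟩
  · rw [closure_Ioo h.ne]
    rcases hz with rfl | rfl
    · exact Set.left_mem_Icc.2 h.le
    · exact Set.right_mem_Icc.2 h.le
  · rcases hz with rfl | rfl <;> simp

lemma mem_relLayer_Ioo {a b x z r : ℝ} (hx : x ∈ Set.Ioo a b) (hz : z = a ∨ z = b)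
    (hz01 : z ∈ Set.Ioo (0 : ℝ) 1) (hr : |x - z| < r) : x ∈ relLayer r (Set.Ioo a b) := by
  refine ⟨hx, (Metric.infEDist_le_edist_of_mem
    (mem_relBdry_Ioo (hx.1.trans hx.2) hz hz01)).trans_lt ?_⟩
  rw [edist_dist, Real.dist_eq]
  exact (ENNReal.ofReal_lt_ofReal_iff_of_nonneg (abs_nonneg _)).2 hr

/-- The image of an open interval under a continuous strictly monotone or antitone function has
its relative boundary among the images of the endpoints. -/
lemma relBdry_image_Ioo_subset {f : ℝ → ℝ} {c d : ℝ} (hcd : c < d)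
    (hf : ContinuousOn f (Set.Icc c d))
    (hmono : StrictMonoOn f (Set.Icc c d) ∨ StrictAntiOn f (Set.Icc c d)) :
    relBdry (f '' Set.Ioo c d) ⊆ {f c, f d} ∩ Set.Ioo 0 1 := by
  have hc : c ∈ Set.Icc c d := Set.left_mem_Icc.2 hcd.le
  have hd : d ∈ Set.Icc c d := Set.right_mem_Icc.2 hcd.le
  rcases hmono with h | h
  · have himage : f '' Set.Ioo c d = Set.Ioo (f c) (f d) := by
      refine Set.Subset.antisymm ?_ (intermediate_value_Ioo hcd.le hf)
      rintro _ ⟨x, hx, rfl⟩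
      exact ⟨h hc (Set.Ioo_subset_Icc_self hx) hx.1, h (Set.Ioo_subset_Icc_self hx) hd hx.2⟩
    rw [himage]
    exact relBdry_Ioo_subset (h hc hd hcd)
  · have himage : f '' Set.Ioo c d = Set.Ioo (f d) (f c) := by
      refine Set.Subset.antisymm ?_ (intermediate_value_Ioo' hcd.le hf)
      rintro _ ⟨x, hx, rfl⟩
      exact ⟨h (Set.Ioo_subset_Icc_self hx) hd hx.2, h hc (Set.Ioo_subset_Icc_self hx) hx.1⟩
    rw [himage, Set.pair_comm]
    exact relBdry_Ioo_subset (h hc hd hcd)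

/-- If `f` agrees on `[lo, hi]` with a continuous `g` expanding distances by `k` there, then a point
of `(a, b) ∩ (lo, hi)` whose image is `ε`-close to the boundary of the image is `ε / k`-close to an
endpoint of `(a, b) ∩ (lo, hi)` with image inside `(0, 1)`. -/
lemma exists_endpoint_near {f g : ℝ → ℝ} {a b lo hi k ε x : ℝ} (hk : 0 < k)
    (hfg : Set.EqOn f g (Set.Icc lo hi)) (hg : Continuous g)
    (hexp : (∀ u ∈ Set.Icc lo hi, ∀ v ∈ Set.Icc lo hi, u ≤ v → k * (v - u) ≤ g v - g u) ∨
      ∀ u ∈ Set.Icc lo hi, ∀ v ∈ Set.Icc lo hi, u ≤ v → k * (v - u) ≤ g u - g v)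
    (hx : x ∈ Set.Ioo a b ∩ Set.Ioo lo hi)
    (hε : Metric.infEDist (f x) (relBdry (f '' (Set.Ioo a b ∩ Set.Ioo lo hi)))
      < ENNReal.ofReal ε) :
    ∃ z, (z = max a lo ∨ z = min b hi) ∧ z ∈ Set.Icc lo hi ∧ g z ∈ Set.Ioo (0 : ℝ) 1 ∧
      k * |x - z| < ε := by
  rw [Set.Ioo_inter_Ioo] at hx hε
  change x ∈ Set.Ioo (max a lo) (min b hi) at hx
  change Metric.infEDist (f x) (relBdry (f '' Set.Ioo (max a lo) (min b hi))) < _ at hε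
  have hlt : max a lo < min b hi := hx.1.trans hx.2
  have hsub : Set.Icc (max a lo) (min b hi) ⊆ Set.Icc lo hi :=
    Set.Icc_subset_Icc (le_max_right _ _) (min_le_right _ _)
  have himage : f '' Set.Ioo (max a lo) (min b hi) = g '' Set.Ioo (max a lo) (min b hi) :=
    (hfg.mono (Set.Ioo_subset_Icc_self.trans hsub)).image_eq
  have hxm : x ∈ Set.Icc lo hi := hsub (Set.Ioo_subset_Icc_self hx)
  rw [himage, hfg hxm, Metric.infEDist_lt_iff] at hε
  obtain ⟨y, hy, hyx⟩ := hε
  have hmono : StrictMonoOn g (Set.Icc lo hi) ∨ StrictAntiOn g (Set.Icc lo hi) := by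
    refine hexp.imp (fun h u hu v hv huv => ?_) (fun h u hu v hv huv => ?_) <;>
    · have := h u hu v hv huv.le
      have := mul_pos hk (sub_pos.2 huv)
      linarith
  obtain ⟨hyg, hy01⟩ := relBdry_image_Ioo_subset hlt hg.continuousOn
    (hmono.imp (fun h => h.mono hsub) (fun h => h.mono hsub)) hy
  rw [edist_dist, Real.dist_eq, ENNReal.ofReal_lt_ofReal_iff_of_nonneg (abs_nonneg _)] at hyx
  obtain ⟨z, hz, rfl⟩ : ∃ z, (z = max a lo ∨ z = min b hi) ∧ g z = y := by
    rcases hyg with rfl | hyg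
    · exact ⟨_, Or.inl rfl, rfl⟩
    · exact ⟨_, Or.inr rfl, (Set.mem_singleton_iff.1 hyg).symm⟩
  have hzm : z ∈ Set.Icc lo hi := by
    rcases hz with rfl | rfl
    · exact hsub (Set.left_mem_Icc.2 hlt.le)
    · exact hsub (Set.right_mem_Icc.2 hlt.le)
  refine ⟨z, hz, hzm, hy01, lt_of_le_of_lt ?_ hyx⟩
  rcases le_total x z with hxz | hxz
  · rw [abs_of_nonpos (sub_nonpos.2 hxz)]
    rcases hexp with h | h
    · exact le_trans (by linarith [h x hxm z hzm hxz]) (neg_le_abs (g x - g z))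
    · exact le_trans (by linarith [h x hxm z hzm hxz]) (le_abs_self (g x - g z))
  · rw [abs_of_nonneg (sub_nonneg.2 hxz)]
    rcases hexp with h | h
    · exact le_trans (by linarith [h z hzm x hxm hxz]) (le_abs_self (g x - g z))
    · exact le_trans (by linarith [h z hzm x hxm hxz]) (neg_le_abs (g x - g z))

/-- The part of the `j`-th summand's set outside the boundary layer of `I`. -/
def excessSet (I : Set ℝ) (ε : ℝ) (j : Fin 4) : Set ℝ :=
  {x ∈ I ∩ WO j |
    EMetric.infEdist (Wmap x) (relBdry (Wmap '' (I ∩ WO j))) < ENNReal.ofReal ε} \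
    relLayer ((112 / 207) * ε) I

/-- On a branch with expansion factor `k ≥ 207 / 112`, a point outside the boundary layer of
`(a, b)` can only be close to a partition point interior to `(a, b)` with image in `(0, 1)`. -/
lemma exists_cut_near {a b lo hi k ε x : ℝ} {g : ℝ → ℝ}
    (hk : 207 / 112 ≤ k) (hfg : Set.EqOn Wmap g (Set.Icc lo hi)) (hg : Continuous g)
    (hexp : (∀ u ∈ Set.Icc lo hi, ∀ v ∈ Set.Icc lo hi, u ≤ v → k * (v - u) ≤ g v - g u) ∨
      ∀ u ∈ Set.Icc lo hi, ∀ v ∈ Set.Icc lo hi, u ≤ v → k * (v - u) ≤ g u - g v)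
    (hlo : 0 ≤ lo) (hhi : hi ≤ 1) (hlo0 : lo = 0 → g lo = 1) (hhi1 : hi = 1 → g hi = 1)
    (hx : x ∈ Set.Ioo a b ∩ Set.Ioo lo hi)
    (hε : Metric.infEDist (Wmap x) (relBdry (Wmap '' (Set.Ioo a b ∩ Set.Ioo lo hi)))
      < ENNReal.ofReal ε)
    (hxL : x ∉ relLayer ((112 / 207) * ε) (Set.Ioo a b)) :
    ∃ z, (z = lo ∨ z = hi) ∧ z ∈ Set.Ioo a b ∧ g z ∈ Set.Ioo (0 : ℝ) 1 ∧ k * |x - z| < ε := by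
  obtain ⟨z, hz, hzm, hgz, hxz⟩ :=
    exists_endpoint_near (by linarith) hfg hg hexp hx hε
  have hz0 : z ≠ 0 := by
    intro h
    have h0 : lo = 0 := le_antisymm (h ▸ hzm.1) hlo
    rw [h.trans h0.symm, hlo0 h0] at hgz
    exact lt_irrefl _ hgz.2
  have hz1 : z ≠ 1 := by
    intro h
    have h0 : hi = 1 := le_antisymm hhi (h ▸ hzm.2)
    rw [h.trans h0.symm, hhi1 h0] at hgz
    exact lt_irrefl _ hgz.2
  have hz01 : z ∈ Set.Ioo (0 : ℝ) 1 :=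
    ⟨lt_of_le_of_ne (hlo.trans hzm.1) hz0.symm, lt_of_le_of_ne (hzm.2.trans hhi) hz1⟩
  have hne : ¬(z = a ∨ z = b) := by
    intro h
    refine hxL (mem_relLayer_Ioo hx.1 h hz01 ?_)
    nlinarith [abs_nonneg (x - z)]
  push Not at hne
  obtain ⟨⟨hxa, hxb⟩, hxlo, hxhi⟩ := hx
  rcases hz with hz | hz
  · rcases max_choice a lo with h | h
    · exact absurd (hz.trans h) hne.1
    · have hzlo := hz.trans h
      have : a ≤ z := hz ▸ le_max_left a lo
      exact ⟨z, Or.inl hzlo, ⟨lt_of_le_of_ne this hne.1.symm, by linarith⟩, hgz, hxz⟩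
  · rcases min_choice b hi with h | h
    · exact absurd (hz.trans h) hne.2
    · have hzhi := hz.trans h
      have : z ≤ b := hz ▸ min_le_left b hi
      exact ⟨z, Or.inr hzhi, ⟨by linarith, lt_of_le_of_ne this hne.2⟩, hgz, hxz⟩

lemma Wmap_eqOn_first : Set.EqOn Wmap (fun x => 1 - (40 / 9) * x) (Set.Icc 0 (9 / 40)) := by
  rintro x ⟨h1, h2⟩
  unfold Wmap
  dsimp only
  split_ifs <;> linarith

lemma Wmap_eqOn_second :
    Set.EqOn Wmap (fun x => 2 * (x - 9 / 40)) (Set.Icc (9 / 40) (9 / 20)) := by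
  rintro x ⟨h1, h2⟩
  unfold Wmap
  dsimp only
  split_ifs <;> linarith

lemma Wmap_eqOn_third :
    Set.EqOn Wmap (fun x => -4 * (x - 9 / 16)) (Set.Icc (9 / 20) (9 / 16)) := by
  rintro x ⟨h1, h2⟩
  unfold Wmap
  dsimp only
  split_ifs with h3 h4 h5
  · linarith
  · linarith
  · rfl
  · obtain rfl : x = 9 / 16 := by linarith
    norm_num

lemma Wmap_eqOn_fourth :
    Set.EqOn Wmap (fun x => x ^ 2 + (81 / 112) * x - 81 / 112) (Set.Icc (9 / 16) 1) := by
  rintro x ⟨h1, h2⟩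
  unfold Wmap
  dsimp only
  split_ifs <;> first | rfl | linarith

section Excess

variable {a b ε : ℝ}

lemma excessSet_first : excessSet (Set.Ioo a b) ε 0 = ∅ := by
  rw [Set.eq_empty_iff_forall_notMem]
  rintro x ⟨⟨hx, hε⟩, hxL⟩
  obtain ⟨z, rfl | rfl, hz, hgz, -⟩ := exists_cut_near (k := 40 / 9) (by norm_num)
    Wmap_eqOn_first (by fun_prop) (Or.inr fun u _ v _ _ => by linarith) le_rfl (by norm_num)
    (by norm_num) (by norm_num) hx hε hxL
  · norm_num at hgz
  · norm_num at hgz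

lemma excessSet_second {x : ℝ} (hx : x ∈ excessSet (Set.Ioo a b) ε 1) :
    9 / 20 ∈ Set.Ioo a b ∧ x ∈ Set.Ioo (9 / 20 - ε / 2) (9 / 20) := by
  obtain ⟨⟨hx, hε⟩, hxL⟩ := hx
  have hx2 : x ∈ Set.Ioo (9 / 40 : ℝ) (9 / 20) := hx.2
  obtain ⟨z, rfl | rfl, hz, hgz, hxz⟩ := exists_cut_near (k := 2) (by norm_num)
    Wmap_eqOn_second (by fun_prop) (Or.inl fun u _ v _ _ => by linarith) (by norm_num)
    (by norm_num) (by norm_num) (by norm_num) hx hε hxL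
  · norm_num at hgz
  · exact ⟨hz, by linarith [neg_le_abs (x - 9 / 20)], hx2.2⟩

lemma excessSet_third {x : ℝ} (hx : x ∈ excessSet (Set.Ioo a b) ε 2) :
    9 / 20 ∈ Set.Ioo a b ∧ x ∈ Set.Ioo (9 / 20) (9 / 20 + ε / 4) := by
  obtain ⟨⟨hx, hε⟩, hxL⟩ := hx
  have hx2 : x ∈ Set.Ioo (9 / 20 : ℝ) (9 / 16) := hx.2
  obtain ⟨z, rfl | rfl, hz, hgz, hxz⟩ := exists_cut_near (k := 4) (by norm_num)
    Wmap_eqOn_third (by fun_prop) (Or.inr fun u _ v _ _ => by linarith) (by norm_num)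
    (by norm_num) (by norm_num) (by norm_num) hx hε hxL
  · exact ⟨hz, hx2.1, by linarith [le_abs_self (x - 9 / 20)]⟩
  · norm_num at hgz

lemma excessSet_fourth : excessSet (Set.Ioo a b) ε 3 = ∅ := by
  rw [Set.eq_empty_iff_forall_notMem]
  rintro x ⟨⟨hx, hε⟩, hxL⟩
  obtain ⟨z, rfl | rfl, hz, hgz, -⟩ := exists_cut_near (k := 207 / 112) le_rfl
    Wmap_eqOn_fourth (by fun_prop)
    (Or.inl fun u hu v hv huv => by nlinarith [hu.1, hv.1, sub_nonneg.2 huv]) (by norm_num)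
    le_rfl (by norm_num) (by norm_num) hx hε hxL
  · norm_num at hgz
  · norm_num at hgz

end Excess

lemma ofReal_two_mul_le_volume_relLayer {a b r : ℝ} (ha : 0 < a) (hb : b < 1) (hr : 0 ≤ r)
    (hab : 2 * r ≤ b - a) :
    ENNReal.ofReal (2 * r) ≤ volume (relLayer r (Set.Ioo a b)) := by
  have hsub : Set.Ioo a (a + r) ∪ Set.Ioo (b - r) b ⊆ relLayer r (Set.Ioo a b) := by
    rintro x (⟨h1, h2⟩ | ⟨h1, h2⟩)
    · refine mem_relLayer_Ioo ⟨h1, by linarith⟩ (Or.inl rfl) ⟨ha, by linarith⟩ ?_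
      rw [abs_of_pos] <;> linarith
    · refine mem_relLayer_Ioo ⟨by linarith, h2⟩ (Or.inr rfl) ⟨by linarith, hb⟩ ?_
      rw [abs_of_neg] <;> linarith
  have hdisj : Disjoint (Set.Ioo a (a + r)) (Set.Ioo (b - r) b) := by
    rw [Set.disjoint_left]
    rintro x ⟨-, h2⟩ ⟨h1, -⟩
    linarith
  refine le_trans (le_of_eq ?_) (measure_mono hsub)
  rw [measure_union hdisj measurableSet_Ioo, Real.volume_Ioo, Real.volume_Ioo,
    ← ENNReal.ofReal_add (by linarith) (by linarith)]
  congr 1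
  ring

lemma relLayer_eq_self {a b r : ℝ} (ha : 0 < a) (hb : b < 1) (hab : b - a < 2 * r) :
    relLayer r (Set.Ioo a b) = Set.Ioo a b := by
  refine Set.Subset.antisymm (fun x hx => hx.1) (fun x hx => ?_)
  obtain ⟨h1, h2⟩ := hx
  rcases lt_or_ge (x - a) r with h | h
  · refine mem_relLayer_Ioo ⟨h1, h2⟩ (Or.inl rfl) ⟨ha, by linarith⟩ ?_
    rwa [abs_of_pos (by linarith)]
  · refine mem_relLayer_Ioo ⟨h1, h2⟩ (Or.inr rfl) ⟨by linarith, hb⟩ ?_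
    rw [abs_of_neg] <;> linarith

lemma sum_volume_excessSet_Ioo_le {a b ε : ℝ} (hab : b - a ≤ 1 / 4)
    (hε : 0 < ε) :
    ∑ j : Fin 4, volume (excessSet (Set.Ioo a b) ε j) ≤
      ENNReal.ofReal (621 / 896) * volume (relLayer ((112 / 207) * ε) (Set.Ioo a b)) := by
  rw [Fin.sum_univ_four, excessSet_first, excessSet_fourth, measure_empty, zero_add,
    add_zero]
  by_cases hcut : (9 / 20 : ℝ) ∈ Set.Ioo a b
  swap
  · rw [Set.eq_empty_iff_forall_notMem.2 fun x hx => hcut (excessSet_second hx).1,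
      Set.eq_empty_iff_forall_notMem.2 fun x hx => hcut (excessSet_third hx).1]
    simp
  have ha' : 0 < a := by linarith [hcut.2]
  have hb' : b < 1 := by linarith [hcut.1]
  rcases lt_or_ge (b - a) (2 * ((112 / 207) * ε)) with h | h
  · have hempty : ∀ j, excessSet (Set.Ioo a b) ε j = ∅ := fun j => by
      rw [excessSet, relLayer_eq_self ha' hb' h, Set.sdiff_eq_empty]
      exact fun x hx => hx.1.1
    simp [hempty]
  · calc volume (excessSet (Set.Ioo a b) ε 1) + volume (excessSet (Set.Ioo a b) ε 2)
        ≤ volume (Set.Ioo (9 / 20 - ε / 2) (9 / 20)) +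
            volume (Set.Ioo (9 / 20) (9 / 20 + ε / 4)) :=
          add_le_add (measure_mono fun x hx => (excessSet_second hx).2)
            (measure_mono fun x hx => (excessSet_third hx).2)
      _ = ENNReal.ofReal (621 / 896) * ENNReal.ofReal (2 * ((112 / 207) * ε)) := by
          rw [Real.volume_Ioo, Real.volume_Ioo, ← ENNReal.ofReal_add (by linarith) (by linarith),
            ← ENNReal.ofReal_mul (by norm_num)]
          congr 1
          ring
      _ ≤ _ := by
          gcongr
          exact ofReal_two_mul_le_volume_relLayer ha' hb' (by positivity) h

lemma eq_Ioo_of_isOpen_ordConnected {I : Set ℝ} (ho : IsOpen I) (hc : I.OrdConnected)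
    (hne : I.Nonempty) (hbelow : BddBelow I) (habove : BddAbove I) :
    I = Set.Ioo (sInf I) (sSup I) := by
  refine Set.Subset.antisymm ?_
    (IsConnected.Ioo_csInf_csSup_subset ⟨hne, hc.isPreconnected⟩ hbelow habove)
  rw [← interior_Icc]
  exact interior_maximal (subset_Icc_csInf_csSup hbelow habove) ho

/-- Dynamical complexity bound for the W-map (hypothesis (H3) with `n₀ = 1`,
`s = 112/207` and `σ = 621/896 < s⁻¹ − 1`): for every nonempty open interval
`I ⊆ (0,1)` with `Leb(I) ≤ 1/4` and every `ε ∈ (0,1/4)`,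
`Σ_{j=1}^{4} Leb({x ∈ I ∩ O_j : dist(Tx, ∂(T(I∩O_j))) < ε} ∖ ∂_{sε}I)
  ≤ (621/896)·Leb(∂_{sε}I)`. -/
theorem Wmap_dynamical_complexity :
    ∀ I : Set ℝ, IsOpen I → I.OrdConnected → I.Nonempty → I ⊆ Set.Ioo 0 1 →
      volume I ≤ ENNReal.ofReal (1 / 4) →
      ∀ ε : ℝ, 0 < ε → ε < 1 / 4 →
        ∑ j : Fin 4,
            volume
              ({x ∈ I ∩ WO j |
                  EMetric.infEdist (Wmap x) (relBdry (Wmap '' (I ∩ WO j))) <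
                    ENNReal.ofReal ε} \
                relLayer ((112 / 207) * ε) I) ≤
          ENNReal.ofReal (621 / 896) * volume (relLayer ((112 / 207) * ε) I) := by
  intro I ho hc hne hI hvol ε hε _
  have hbelow : BddBelow I := bddBelow_Ioo.mono hI
  have habove : BddAbove I := bddAbove_Ioo.mono hI
  have hIoo := eq_Ioo_of_isOpen_ordConnected ho hc hne hbelow habove
  generalize sInf I = a at hIoo
  generalize sSup I = b at hIoo
  subst hIoo
  rw [Real.volume_Ioo, ENNReal.ofReal_le_ofReal_iff (by norm_num)] at hvol
  exact sum_volume_excessSet_Ioo_le hvol hε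
end

section
/- Interval growth lemma for the W-map. Let T be the W-map with partition intervals O₁, O₂, O₃, O₄. For every δ₁ > 0 there exists Ñ ∈ ℕ such that for every open interval J ⊆ (0,1) with Leb(J) ≥ δ₁ there exist an integer N with 0 ≤ N ≤ Ñ and an open interval J′ ⊆ J such that: (a) for every 0 ≤ k < N, T^k(J′) is contained in one of the intervals O₁, O₂, O₃, O₄; (b) T^N(J′) contains one of the intervals O₁, O₂, O₃, O₄; and (c) |T^N(x) − T^N(y)| ≤ (40/9)^N·|x−y| for all x,y ∈ J′ (i.e. the expansion of T^N on J′ is at most (9/40)^{−N}). -/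
open MeasureTheory

/-- The conclusion of the growth lemma: some open subinterval of `J` evolves inside the partition
for at most `n` steps, with controlled expansion, until it covers a partition interval. -/
def WGrows (n : ℕ) (J : Set ℝ) : Prop :=
  ∃ (N : ℕ) (J' : Set ℝ), N ≤ n ∧ IsOpen J' ∧ J'.OrdConnected ∧ J' ⊆ J ∧
    (∀ k : ℕ, k < N → ∃ j : Fin 4, (Wmap^[k]) '' J' ⊆ WO j) ∧
    (∃ j : Fin 4, WO j ⊆ (Wmap^[N]) '' J') ∧
    ∀ x ∈ J', ∀ y ∈ J', |(Wmap^[N]) x - (Wmap^[N]) y| ≤ (40 / 9) ^ N * |x - y|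

lemma WGrows.mono {n : ℕ} {I J : Set ℝ} (h : WGrows n I) (hIJ : I ⊆ J) : WGrows n J := by
  obtain ⟨N, J', hN, ho, hc, hs, h⟩ := h
  exact ⟨N, J', hN, ho, hc, hs.trans hIJ, h⟩

lemma WGrows.of_subset {n : ℕ} {a b : ℝ} (j : Fin 4) (h : WO j ⊆ Set.Ioo a b) :
    WGrows n (Set.Ioo a b) :=
  ⟨0, Set.Ioo a b, n.zero_le, isOpen_Ioo, Set.ordConnected_Ioo, subset_rfl,
    fun k hk => absurd hk k.not_lt_zero, ⟨j, by simpa using h⟩, by simp⟩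

lemma Wmap_eq_first {x : ℝ} (h : x ≤ 9 / 40) : Wmap x = 1 - (40 / 9) * x := by
  unfold Wmap
  split_ifs <;> first | rfl | linarith

lemma Wmap_eq_second {x : ℝ} (h : 9 / 40 ≤ x) (h' : x ≤ 9 / 20) :
    Wmap x = 2 * (x - 9 / 40) := by
  unfold Wmap
  split_ifs <;> first | rfl | linarith

lemma Wmap_eq_third {x : ℝ} (h : 9 / 20 ≤ x) (h' : x ≤ 9 / 16) :
    Wmap x = -4 * (x - 9 / 16) := by
  unfold Wmap
  split_ifs <;> first | rfl | linarith | nlinarith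

lemma Wmap_eq_fourth {x : ℝ} (h : 9 / 16 ≤ x) :
    Wmap x = x ^ 2 + (81 / 112) * x - 81 / 112 := by
  unfold Wmap
  split_ifs <;> first | rfl | linarith

lemma continuous_Wmap : Continuous Wmap := by
  unfold Wmap
  simp only [← not_le, ite_not]
  refine Continuous.if_le (Continuous.if_le (Continuous.if_le (by fun_prop) (by fun_prop)
    continuous_const continuous_id ?_) (by fun_prop) continuous_const continuous_id ?_)
    (by fun_prop) continuous_const continuous_id ?_ <;>
  · rintro x rfl
    norm_num

lemma abs_Wmap_sub_le {j : Fin 4} {x y : ℝ} (hx : x ∈ WO j) (hy : y ∈ WO j) :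
    |Wmap x - Wmap y| ≤ 40 / 9 * |x - y| := by
  suffices h : ∃ s : ℝ, |s| ≤ 40 / 9 ∧ Wmap x - Wmap y = s * (x - y) by
    obtain ⟨s, hs, h⟩ := h
    rw [h, abs_mul]
    gcongr
  fin_cases j <;> simp [WO] at hx hy
  · refine ⟨-(40 / 9), by norm_num [abs_le], ?_⟩
    rw [Wmap_eq_first hx.2.le, Wmap_eq_first hy.2.le]
    ring
  · refine ⟨2, by norm_num, ?_⟩
    rw [Wmap_eq_second hx.1.le hx.2.le, Wmap_eq_second hy.1.le hy.2.le]
    ring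
  · refine ⟨-4, by norm_num [abs_le], ?_⟩
    rw [Wmap_eq_third hx.1.le hx.2.le, Wmap_eq_third hy.1.le hy.2.le]
    ring
  · refine ⟨x + y + 81 / 112, abs_le.2 ⟨by linarith, by linarith⟩, ?_⟩
    rw [Wmap_eq_fourth hx.1.le, Wmap_eq_fourth hy.1.le]
    ring

lemma WGrows.of_image {n : ℕ} {c d : ℝ} {j : Fin 4} (hj : Set.Ioo c d ⊆ WO j)
    (hmono : MonotoneOn Wmap (Set.Ioo c d) ∨ AntitoneOn Wmap (Set.Ioo c d))
    (h : WGrows n (Wmap '' Set.Ioo c d)) : WGrows (n + 1) (Set.Ioo c d) := by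
  obtain ⟨N, K, hN, hKo, hKc, hKs, hpart, hcover, hlip⟩ := h
  have himage : Wmap '' (Set.Ioo c d ∩ Wmap ⁻¹' K) = K := by
    rw [Set.image_inter_preimage, Set.inter_eq_right.2 hKs]
  refine ⟨N + 1, Set.Ioo c d ∩ Wmap ⁻¹' K, by omega,
    isOpen_Ioo.inter (hKo.preimage continuous_Wmap), ⟨?_⟩, Set.inter_subset_left, ?_, ?_, ?_⟩
  · rintro x ⟨hx, hxK⟩ y ⟨hy, hyK⟩ z hz
    have hzI : z ∈ Set.Ioo c d := ⟨hx.1.trans_le hz.1, hz.2.trans_lt hy.2⟩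
    refine ⟨hzI, ?_⟩
    rcases hmono with hm | hm
    · exact hKc.out hxK hyK ⟨hm hx hzI hz.1, hm hzI hy hz.2⟩
    · exact hKc.out hyK hxK ⟨hm hzI hy hz.2, hm hx hzI hz.1⟩
  · rintro (_ | k) hk
    · exact ⟨j, by simpa using Set.inter_subset_left.trans hj⟩
    · obtain ⟨i, hi⟩ := hpart k (by omega)
      exact ⟨i, by rwa [Function.iterate_succ, Set.image_comp, himage]⟩
  · obtain ⟨i, hi⟩ := hcover
    exact ⟨i, by rwa [Function.iterate_succ, Set.image_comp, himage]⟩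
  · rintro x ⟨hx, hxK⟩ y ⟨hy, hyK⟩
    calc |(Wmap^[N + 1]) x - (Wmap^[N + 1]) y|
        ≤ (40 / 9) ^ N * |Wmap x - Wmap y| := hlip _ hxK _ hyK
      _ ≤ (40 / 9) ^ N * (40 / 9 * |x - y|) := by
        gcongr
        exact abs_Wmap_sub_le (hj hx) (hj hy)
      _ = (40 / 9) ^ (N + 1) * |x - y| := by ring

/-- Every interval in the unit interval of length at least `ε` grows within `n` steps. -/
def WGrowsFrom (n : ℕ) (ε : ℝ) : Prop :=
  ∀ a b : ℝ, 0 ≤ a → b ≤ 1 → ε ≤ b - a → WGrows n (Set.Ioo a b)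

lemma WGrowsFrom.of_strictMonoOn {n : ℕ} {ε c d : ℝ} {j : Fin 4} (H : WGrowsFrom n ε)
    (hcd : c ≤ d) (hj : Set.Ioo c d ⊆ WO j) (hm : StrictMonoOn Wmap (Set.Icc c d))
    (h0 : 0 ≤ Wmap c) (h1 : Wmap d ≤ 1) (hε : ε ≤ Wmap d - Wmap c) :
    WGrows (n + 1) (Set.Ioo c d) :=
  .of_image hj (.inl (hm.monotoneOn.mono Set.Ioo_subset_Icc_self)) <|
    (H _ _ h0 h1 hε).mono (intermediate_value_Ioo hcd continuous_Wmap.continuousOn)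

lemma WGrowsFrom.of_strictAntiOn {n : ℕ} {ε c d : ℝ} {j : Fin 4} (H : WGrowsFrom n ε)
    (hcd : c ≤ d) (hj : Set.Ioo c d ⊆ WO j) (hm : StrictAntiOn Wmap (Set.Icc c d))
    (h0 : 0 ≤ Wmap d) (h1 : Wmap c ≤ 1) (hε : ε ≤ Wmap c - Wmap d) :
    WGrows (n + 1) (Set.Ioo c d) :=
  .of_image hj (.inr (hm.antitoneOn.mono Set.Ioo_subset_Icc_self)) <|
    (H _ _ h0 h1 hε).mono (intermediate_value_Ioo' hcd continuous_Wmap.continuousOn)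

lemma WGrowsFrom.first {n : ℕ} {ε c d : ℝ} (H : WGrowsFrom n ε) (hc : 0 ≤ c) (hcd : c ≤ d)
    (hd : d ≤ 9 / 40) (hε : ε ≤ 40 / 9 * (d - c)) : WGrows (n + 1) (Set.Ioo c d) := by
  have ec := Wmap_eq_first (hcd.trans hd)
  have ed := Wmap_eq_first hd
  refine H.of_strictAntiOn (j := 0) hcd (Set.Ioo_subset_Ioo hc hd) (fun x hx y hy hxy => ?_)
    (by linarith) (by linarith) (by linarith)
  rw [Wmap_eq_first (hx.2.trans hd), Wmap_eq_first (hy.2.trans hd)]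
  linarith

lemma WGrowsFrom.second {n : ℕ} {ε c d : ℝ} (H : WGrowsFrom n ε) (hc : 9 / 40 ≤ c) (hcd : c ≤ d)
    (hd : d ≤ 9 / 20) (hε : ε ≤ 2 * (d - c)) : WGrows (n + 1) (Set.Ioo c d) := by
  have ec := Wmap_eq_second hc (hcd.trans hd)
  have ed := Wmap_eq_second (hc.trans hcd) hd
  refine H.of_strictMonoOn (j := 1) hcd (Set.Ioo_subset_Ioo hc hd) (fun x hx y hy hxy => ?_)
    (by linarith) (by linarith) (by linarith)
  rw [Wmap_eq_second (hc.trans hx.1) (hx.2.trans hd),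
    Wmap_eq_second (hc.trans hy.1) (hy.2.trans hd)]
  linarith

lemma WGrowsFrom.third {n : ℕ} {ε c d : ℝ} (H : WGrowsFrom n ε) (hc : 9 / 20 ≤ c) (hcd : c ≤ d)
    (hd : d ≤ 9 / 16) (hε : ε ≤ 4 * (d - c)) : WGrows (n + 1) (Set.Ioo c d) := by
  have ec := Wmap_eq_third hc (hcd.trans hd)
  have ed := Wmap_eq_third (hc.trans hcd) hd
  refine H.of_strictAntiOn (j := 2) hcd (Set.Ioo_subset_Ioo hc hd) (fun x hx y hy hxy => ?_)
    (by linarith) (by linarith) (by linarith)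
  rw [Wmap_eq_third (hc.trans hx.1) (hx.2.trans hd),
    Wmap_eq_third (hc.trans hy.1) (hy.2.trans hd)]
  linarith

lemma WGrowsFrom.fourth {n : ℕ} {ε c d : ℝ} (H : WGrowsFrom n ε) (hc : 9 / 16 ≤ c) (hcd : c ≤ d)
    (hd : d ≤ 1) (hε : ε ≤ 9 / 5 * (d - c)) : WGrows (n + 1) (Set.Ioo c d) := by
  have ec := Wmap_eq_fourth hc
  have ed := Wmap_eq_fourth (hc.trans hcd)
  refine H.of_strictMonoOn (j := 3) hcd (Set.Ioo_subset_Ioo hc hd) (fun x hx y hy hxy => ?_)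
    (by nlinarith) (by nlinarith) (by nlinarith)
  rw [Wmap_eq_fourth (hc.trans hx.1), Wmap_eq_fourth (hc.trans hy.1)]
  nlinarith [hx.1]

/-- An interval covering no partition interval meets at most one partition point, and the longer
image of its pieces has at least `6 / 5` times its length. -/
lemma WGrowsFrom.succ {n : ℕ} {ε : ℝ} (hε : 0 < ε) (H : WGrowsFrom n ε) :
    WGrowsFrom (n + 1) (5 / 6 * ε) := by
  intro a b ha hb hab
  have left {p : ℝ} (hp : p ≤ b) (h : WGrows (n + 1) (Set.Ioo a p)) :
      WGrows (n + 1) (Set.Ioo a b) := h.mono (Set.Ioo_subset_Ioo_right hp)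
  have right {p : ℝ} (hp : a ≤ p) (h : WGrows (n + 1) (Set.Ioo p b)) :
      WGrows (n + 1) (Set.Ioo a b) := h.mono (Set.Ioo_subset_Ioo_left hp)
  rcases lt_or_ge a (9 / 40) with h1 | h1
  · rcases le_or_gt b (9 / 40) with h2 | h2
    · exact H.first ha (by linarith) h2 (by linarith)
    rcases le_or_gt b (9 / 20) with h3 | h3
    · rcases le_or_gt ε (40 / 9 * (9 / 40 - a)) with h | h
      · exact left h2.le (H.first ha h1.le le_rfl h)
      · exact right h1.le (H.second le_rfl h2.le h3 (by linarith))
    · exact .of_subset 1 (Set.Ioo_subset_Ioo h1.le h3.le)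
  rcases lt_or_ge a (9 / 20) with h2 | h2
  · rcases le_or_gt b (9 / 20) with h3 | h3
    · exact H.second h1 (by linarith) h3 (by linarith)
    rcases le_or_gt b (9 / 16) with h4 | h4
    · rcases le_or_gt ε (2 * (9 / 20 - a)) with h | h
      · exact left h3.le (H.second h1 h2.le le_rfl h)
      · exact right h2.le (H.third le_rfl h3.le h4 (by linarith))
    · exact .of_subset 2 (Set.Ioo_subset_Ioo h2.le h4.le)
  rcases lt_or_ge a (9 / 16) with h3 | h3
  · rcases le_or_gt b (9 / 16) with h4 | h4
    · exact H.third h2 (by linarith) h4 (by linarith)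
    rcases le_or_gt ε (4 * (9 / 16 - a)) with h | h
    · exact left h4.le (H.third h2 h3.le le_rfl h)
    · exact right h3.le (H.fourth le_rfl h4.le hb (by linarith))
  · exact H.fourth h3 (by linarith) hb (by linarith)

lemma WGrowsFrom_pow (n : ℕ) : WGrowsFrom n ((5 / 6) ^ n) := by
  induction n with
  | zero =>
    intro a b ha hb hab
    rw [pow_zero] at hab
    exact .of_subset 0 (Set.Ioo_subset_Ioo (by linarith) (by linarith))
  | succ n ih =>
    rw [pow_succ']
    exact ih.succ (by positivity)

/-- Interval growth lemma for the W-map.  For every `δ₁ > 0` there is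
`Ñ ∈ ℕ` such that every open interval `J ⊆ (0,1)` with `Leb(J) ≥ δ₁` contains an open
interval `J′` and there is `N ≤ Ñ` such that: (a) each `T^k(J′)`, `k < N`, is contained in
one of the partition intervals; (b) `T^N(J′)` contains a partition interval; (c) `T^N`
expands on `J′` by a factor of at most `(40/9)^N`. -/
theorem Wmap_interval_growth :
    ∀ δ₁ : ℝ, 0 < δ₁ →
      ∃ Ntilde : ℕ,
        ∀ J : Set ℝ, IsOpen J → J.OrdConnected → J ⊆ Set.Ioo 0 1 →
          ENNReal.ofReal δ₁ ≤ volume J →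
          ∃ (N : ℕ) (J' : Set ℝ), N ≤ Ntilde ∧ IsOpen J' ∧ J'.OrdConnected ∧ J' ⊆ J ∧
            (∀ k : ℕ, k < N → ∃ j : Fin 4, (Wmap^[k]) '' J' ⊆ WO j) ∧
            (∃ j : Fin 4, WO j ⊆ (Wmap^[N]) '' J') ∧
            ∀ x ∈ J', ∀ y ∈ J',
              |(Wmap^[N]) x - (Wmap^[N]) y| ≤ (40 / 9) ^ N * |x - y| := by
  intro δ hδ
  obtain ⟨n, hn⟩ := exists_pow_lt_of_lt_one hδ (by norm_num : (5 / 6 : ℝ) < 1)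
  refine ⟨n, fun J _ hconn hJ hvol => ?_⟩
  have hne : J.Nonempty := by
    rw [Set.nonempty_iff_ne_empty]
    rintro rfl
    simp [hδ.not_ge] at hvol
  have hbb : BddBelow J := bddBelow_Ioo.mono hJ
  have hba : BddAbove J := bddAbove_Ioo.mono hJ
  have hlen : δ ≤ sSup J - sInf J := by
    have h := hvol.trans (measure_mono (subset_Icc_csInf_csSup hbb hba))
    rw [Real.volume_Icc] at h
    by_contra! hlt
    exact h.not_gt ((ENNReal.ofReal_lt_ofReal_iff hδ).2 hlt)
  exact (WGrowsFrom_pow n _ _ (le_csInf hne fun x hx => (hJ hx).1.le)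
    (csSup_le hne fun x hx => (hJ hx).2.le) (hn.le.trans hlen)).mono
    (IsConnected.Ioo_csInf_csSup_subset ⟨hne, hconn.isPreconnected⟩ hbb hba)
end

section
/- Interval growth lemma for a non-Markov map of the half-line. Let T be the map of (0,∞) defined in the context, with partition elements O₁, O₂, O₃, …. For every δ₁ > 0 there exist Ñ ∈ ℕ and Γ > 0 such that for every interval J ⊆ (0,∞) with Leb(J) ≥ δ₁ there exist an integer N with 0 ≤ N ≤ Ñ and an open interval J′ ⊆ J such that: (a) for every 0 ≤ k < N, T^k(J′) is contained in a single partition element O_m; (b) T^N(J′) contains some partition element O_m; and (c) |T^N(x) − T^N(y)| ≤ Γ^{−N}·|x−y| for all x,y ∈ J′. -/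
open MeasureTheory

/-- The non-Markov map of the half-line `(0,∞)` (with `t = 1/10`): for each integer
`k ≥ 1`, `T(x) = (10 + 2^{-k})(x - k + 1)` on `(k-1, k-1/10)` and `T(x) = 1/(k-x)` on
`(k-1/10, k)`.  Values at the partition endpoints are irrelevant. -/
noncomputable def Tmap (x : ℝ) : ℝ :=
  if x < (⌈x⌉ : ℝ) - 1 / 10 then (10 + (2 : ℝ) ^ (-⌈x⌉)) * (x - (⌈x⌉ : ℝ) + 1)
  else 1 / ((⌈x⌉ : ℝ) - x)

/-- The (mod 0) partition `{O_m}` of `(0,∞)` into the open intervals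
`O_{2k-1} = (k-1, k-1/10)` and `O_{2k} = (k-1/10, k)`, `k ≥ 1`. -/
def Tparts : Set (Set ℝ) :=
  {S | ∃ k : ℕ, 1 ≤ k ∧
    (S = Set.Ioo ((k : ℝ) - 1) ((k : ℝ) - 1 / 10) ∨
      S = Set.Ioo ((k : ℝ) - 1 / 10) (k : ℝ))}

lemma Tmap_of_mem_linear {k : ℕ} {x : ℝ} (hx : x ∈ Set.Ioo ((k : ℝ) - 1) ((k : ℝ) - 1 / 10)) :
    Tmap x = (10 + (2 : ℝ) ^ (-(k : ℤ))) * (x - k + 1) := by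
  obtain ⟨h₁, h₂⟩ := hx
  have hc : ⌈x⌉ = (k : ℤ) := by
    rw [Int.ceil_eq_iff]
    push_cast
    constructor <;> linarith
  simp only [Tmap, hc, Int.cast_natCast]
  rw [if_pos h₂]

lemma Tmap_of_mem_hyperbolic {k : ℕ} {x : ℝ} (hx : x ∈ Set.Ioo ((k : ℝ) - 1 / 10) (k : ℝ)) :
    Tmap x = 1 / (k - x) := by
  obtain ⟨h₁, h₂⟩ := hx
  have hc : ⌈x⌉ = (k : ℤ) := by
    rw [Int.ceil_eq_iff]
    push_cast
    constructor <;> linarith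
  simp only [Tmap, hc, Int.cast_natCast]
  rw [if_neg (by linarith)]

/-- `(a, b)` contains an open interval inside one partition element on which `Tmap` is monotone,
continuous and `L`-Lipschitz, and whose image covers an interval of `(0, ∞)` of length `ℓ`. -/
def HasGrowingBranch (L ℓ a b : ℝ) : Prop :=
  ∃ c d c' d' : ℝ, Set.Ioo c d ⊆ Set.Ioo a b ∧ (∃ S ∈ Tparts, Set.Ioo c d ⊆ S) ∧
    0 ≤ c' ∧ ℓ ≤ d' - c' ∧ MonotoneOn Tmap (Set.Ioo c d) ∧ ContinuousOn Tmap (Set.Ioo c d) ∧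
    Set.Ioo c' d' ⊆ Tmap '' Set.Ioo c d ∧
    ∀ x ∈ Set.Ioo c d, ∀ y ∈ Set.Ioo c d, |Tmap x - Tmap y| ≤ L * |x - y|

lemma HasGrowingBranch.mono {L ℓ ℓ' a b a' b' : ℝ} (h : HasGrowingBranch L ℓ a b)
    (hℓ : ℓ' ≤ ℓ) (ha : a' ≤ a) (hb : b ≤ b') : HasGrowingBranch L ℓ' a' b' := by
  obtain ⟨c, d, c', d', h₁, h₂, h₃, h₄, h₅⟩ := h
  exact ⟨c, d, c', d', h₁.trans (Set.Ioo_subset_Ioo ha hb), h₂, h₃, hℓ.trans h₄, h₅⟩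

lemma hasGrowingBranch_linear {L c d : ℝ} {k : ℕ} (hk : 1 ≤ k) (hL : 11 ≤ L)
    (hc : (k : ℝ) - 1 ≤ c) (hcd : c < d) (hd : d ≤ (k : ℝ) - 1 / 10) :
    HasGrowingBranch L (4 * (d - c)) c d := by
  have hsub := Set.Ioo_subset_Ioo hc hd
  set m : ℝ := 10 + (2 : ℝ) ^ (-(k : ℤ)) with hm
  have hm10 : 10 ≤ m := by
    have : (0 : ℝ) < 2 ^ (-(k : ℤ)) := by positivity
    linarith
  have hm11 : m ≤ 11 := by
    have : (2 : ℝ) ^ (-(k : ℤ)) ≤ 1 := zpow_le_one_of_nonpos₀ (by norm_num) (by omega)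
    linarith
  have hT : ∀ x ∈ Set.Ioo c d, Tmap x = m * (x - k + 1) := fun x hx =>
    Tmap_of_mem_linear (hsub hx)
  refine ⟨c, d, m * (c - k + 1), m * (d - k + 1), subset_rfl, ⟨_, ⟨k, hk, Or.inl rfl⟩, hsub⟩,
    by apply mul_nonneg <;> linarith, by nlinarith, ?_, ?_, ?_, ?_⟩
  · intro x hx y hy hxy
    rw [hT x hx, hT y hy]
    gcongr
  · exact ContinuousOn.congr (by fun_prop) hT
  · rintro y ⟨hy₁, hy₂⟩
    have hm0 : 0 < m := by linarith
    have hx : y / m + k - 1 ∈ Set.Ioo c d := by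
      have h₁ : c - k + 1 < y / m := by rw [lt_div_iff₀ hm0]; linarith
      have h₂ : y / m < d - k + 1 := by rw [div_lt_iff₀ hm0]; linarith
      constructor <;> linarith
    refine ⟨_, hx, ?_⟩
    rw [hT _ hx]
    field_simp
    ring
  · intro x hx y hy
    rw [hT x hx, hT y hy, ← mul_sub, abs_mul, abs_of_nonneg (by linarith : 0 ≤ m)]
    have : x - k + 1 - (y - k + 1) = x - y := by ring
    rw [this]
    gcongr
    linarith

lemma hasGrowingBranch_hyperbolic {δ L c d : ℝ} {k : ℕ} (hk : 1 ≤ k) (hδ : 0 < δ)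
    (hL : 4 / δ ^ 2 ≤ L) (hc : (k : ℝ) - 1 / 10 ≤ c) (hcd : δ ≤ d - c) (hd : d ≤ k) :
    HasGrowingBranch L (4 * (d - c)) c d := by
  set e := (c + d) / 2 with he
  have hsub : Set.Ioo c e ⊆ Set.Ioo ((k : ℝ) - 1 / 10) k := Set.Ioo_subset_Ioo hc (by linarith)
  have hT : ∀ x ∈ Set.Ioo c e, Tmap x = 1 / (k - x) := fun x hx =>
    Tmap_of_mem_hyperbolic (hsub hx)
  have hke : δ / 2 ≤ k - e := by linarith
  have hkc : 0 < k - c := by linarith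
  have hke0 : 0 < k - e := by linarith
  refine ⟨c, e, 1 / (k - c), 1 / (k - e), Set.Ioo_subset_Ioo le_rfl (by linarith),
    ⟨_, ⟨k, hk, Or.inr rfl⟩, hsub⟩, by positivity, ?_, ?_, ?_, ?_, ?_⟩
  · have : 1 / ((k : ℝ) - e) - 1 / (k - c) = (e - c) / ((k - e) * (k - c)) := by
      field_simp
      ring
    rw [this, le_div_iff₀ (by positivity)]
    have : (k - e) * (k - c) ≤ (1 / 10) * (1 / 10) := by gcongr <;> linarith
    nlinarith
  · intro x hx y hy hxy
    rw [hT x hx, hT y hy]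
    have := hy.2
    apply one_div_le_one_div_of_le <;> linarith
  · refine ContinuousOn.congr (f := fun x => 1 / ((k : ℝ) - x)) ?_ hT
    refine continuousOn_const.div (by fun_prop) fun x hx => ?_
    have := hx.2
    linarith
  · rintro y ⟨hy₁, hy₂⟩
    have hy : 0 < y := lt_trans (by positivity) hy₁
    have hx : k - 1 / y ∈ Set.Ioo c e := by
      have h₁ : 1 / y < k - c := (one_div_lt hkc hy).1 hy₁
      have h₂ : k - e < 1 / y := (lt_one_div hy hke0).1 hy₂
      constructor <;> linarith
    refine ⟨_, hx, ?_⟩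
    rw [hT _ hx]
    simp
  · intro x hx y hy
    rw [hT x hx, hT y hy]
    have hx' : δ / 2 ≤ k - x := by linarith [hx.2]
    have hy' : δ / 2 ≤ k - y := by linarith [hy.2]
    have hx0 : 0 < k - x := by linarith
    have hy0 : 0 < k - y := by linarith
    have : 1 / ((k : ℝ) - x) - 1 / (k - y) = (x - y) / ((k - x) * (k - y)) := by
      field_simp
      ring
    rw [this, abs_div, abs_of_pos (mul_pos hx0 hy0), div_eq_inv_mul]
    refine mul_le_mul_of_nonneg_right (le_trans ?_ hL) (abs_nonneg _)
    calc ((k - x) * (k - y))⁻¹ ≤ (δ / 2 * (δ / 2))⁻¹ := by gcongr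
      _ = 4 / δ ^ 2 := by field_simp; norm_num

/-- An interval of length at least `δ` either contains a partition element or has a branch of
`Tmap` whose image is at least twice as long. -/
lemma exists_part_subset_or_hasGrowingBranch {δ L a b : ℝ} (hδ : 0 < δ) (hL₁ : 11 ≤ L)
    (hL₂ : 16 / δ ^ 2 ≤ L) (ha : 0 ≤ a) (hab : δ ≤ b - a) :
    (∃ S ∈ Tparts, S ⊆ Set.Ioo a b) ∨ HasGrowingBranch L (2 * (b - a)) a b := by
  obtain ⟨k, hk, hka, hak⟩ : ∃ k : ℕ, 1 ≤ k ∧ (k : ℝ) - 1 ≤ a ∧ a < k := by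
    refine ⟨⌊a⌋₊ + 1, by omega, ?_, ?_⟩
    · push_cast
      linarith [Nat.floor_le ha]
    · push_cast
      exact Nat.lt_floor_add_one a
  have hL₃ : 4 / (δ / 2) ^ 2 ≤ L := by
    convert hL₂ using 1
    field_simp
    norm_num
  rcases lt_or_ge a ((k : ℝ) - 1 / 10) with h | h
  · rcases lt_or_ge (k : ℝ) b with hb | hb
    · exact Or.inl ⟨_, ⟨k, hk, Or.inr rfl⟩, Set.Ioo_subset_Ioo h.le hb.le⟩
    right
    by_cases h' : (a + b) / 2 ≤ (k : ℝ) - 1 / 10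
    · exact (hasGrowingBranch_linear hk hL₁ hka (d := (a + b) / 2) (by linarith) h').mono
        (by linarith) le_rfl (by linarith)
    · push Not at h'
      exact (hasGrowingBranch_hyperbolic hk (half_pos hδ) hL₃ (c := (a + b) / 2) h'.le
        (by linarith) hb).mono (by linarith) (by linarith) le_rfl
  · rcases lt_or_ge ((k : ℝ) + 9 / 10) b with hb | hb
    · refine Or.inl ⟨_, ⟨k + 1, by omega, Or.inl rfl⟩, Set.Ioo_subset_Ioo ?_ ?_⟩ <;>
        push_cast <;> linarith
    right
    by_cases h' : (a + b) / 2 ≤ (k : ℝ)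
    · exact (hasGrowingBranch_hyperbolic hk (half_pos hδ) hL₃ (d := (a + b) / 2) h
        (by linarith) h').mono (by linarith) le_rfl (by linarith)
    · push Not at h'
      exact (hasGrowingBranch_linear (k := k + 1) (by omega) hL₁ (c := (a + b) / 2)
        (by push_cast; linarith) (by linarith) (by push_cast; linarith)).mono
        (by linarith) (by linarith) le_rfl

lemma exists_part_subset_of_two_le {a b : ℝ} (ha : 0 ≤ a) (hab : 2 ≤ b - a) :
    ∃ S ∈ Tparts, S ⊆ Set.Ioo a b := by
  refine ⟨_, ⟨⌈a⌉₊ + 1, by omega, Or.inl rfl⟩, Set.Ioo_subset_Ioo ?_ ?_⟩ <;> push_cast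
  · linarith [Nat.le_ceil a]
  · linarith [Nat.ceil_lt_add_one ha]

/-- The growth lemma for open intervals whose length is at least `2 / 2 ^ n`. -/
lemma Tmap_Ioo_growth {δ L : ℝ} (hδ : 0 < δ) (hL₁ : 11 ≤ L) (hL₂ : 16 / δ ^ 2 ≤ L) (n : ℕ) :
    ∀ a b : ℝ, 0 ≤ a → δ ≤ b - a → 2 ≤ 2 ^ n * (b - a) →
      ∃ (N : ℕ) (J' : Set ℝ), N ≤ n ∧ IsOpen J' ∧ J'.OrdConnected ∧ J' ⊆ Set.Ioo a b ∧
        (∀ k : ℕ, k < N → ∃ S ∈ Tparts, (Tmap^[k]) '' J' ⊆ S) ∧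
        (∃ S ∈ Tparts, S ⊆ (Tmap^[N]) '' J') ∧
        ∀ x ∈ J', ∀ y ∈ J', |(Tmap^[N]) x - (Tmap^[N]) y| ≤ L ^ N * |x - y| := by
  have base : ∀ (n : ℕ) (a b : ℝ), (∃ S ∈ Tparts, S ⊆ Set.Ioo a b) →
      ∃ (N : ℕ) (J' : Set ℝ), N ≤ n ∧ IsOpen J' ∧ J'.OrdConnected ∧ J' ⊆ Set.Ioo a b ∧
        (∀ k : ℕ, k < N → ∃ S ∈ Tparts, (Tmap^[k]) '' J' ⊆ S) ∧
        (∃ S ∈ Tparts, S ⊆ (Tmap^[N]) '' J') ∧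
        ∀ x ∈ J', ∀ y ∈ J', |(Tmap^[N]) x - (Tmap^[N]) y| ≤ L ^ N * |x - y| :=
    fun n a b h => ⟨0, Set.Ioo a b, Nat.zero_le n, isOpen_Ioo, Set.ordConnected_Ioo, subset_rfl,
      by simp, by simpa using h, by simp⟩
  induction n with
  | zero =>
    intro a b ha _ hab
    exact base 0 a b (exists_part_subset_of_two_le ha (by linarith))
  | succ n ih =>
    intro a b ha hδab hab
    rcases exists_part_subset_or_hasGrowingBranch hδ hL₁ hL₂ ha hδab with h | h
    · exact base _ a b h
    obtain ⟨c, d, c', d', hsub, ⟨S, hS, hcdS⟩, hc', hlen, hmono, hcont, himg, hlip⟩ := h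
    obtain ⟨N, K, hN, hKo, hKc, hKsub, hparts, hcover, hKlip⟩ := ih c' d' hc' (by linarith) (by
      have : (2 : ℝ) ^ n * (2 * (b - a)) ≤ 2 ^ n * (d' - c') := by gcongr
      rw [pow_succ] at hab
      linarith)
    have hTK : Tmap '' (Set.Ioo c d ∩ Tmap ⁻¹' K) = K := by
      rw [Set.image_inter_preimage]
      exact Set.inter_eq_right.2 (hKsub.trans himg)
    have hiter : ∀ k, (Tmap^[k + 1]) '' (Set.Ioo c d ∩ Tmap ⁻¹' K) = (Tmap^[k]) '' K := by
      intro k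
      rw [Function.iterate_succ, Set.image_comp, hTK]
    refine ⟨N + 1, Set.Ioo c d ∩ Tmap ⁻¹' K, by omega,
      hcont.isOpen_inter_preimage isOpen_Ioo hKo, ⟨?_⟩,
      Set.inter_subset_left.trans hsub, ?_, ?_, ?_⟩
    · rintro x ⟨hx, hxK⟩ y ⟨hy, hyK⟩ z hz
      have hzI : z ∈ Set.Ioo c d := ⟨hx.1.trans_le hz.1, hz.2.trans_lt hy.2⟩
      exact ⟨hzI, hKc.out hxK hyK ⟨hmono hx hzI hz.1, hmono hzI hy hz.2⟩⟩
    · rintro (_ | k) hk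
      · exact ⟨S, hS, by simpa using Set.inter_subset_left.trans hcdS⟩
      · rw [hiter]
        exact hparts k (by omega)
    · rwa [hiter]
    · rintro x ⟨hx, hxK⟩ y ⟨hy, hyK⟩
      rw [Function.iterate_succ_apply, Function.iterate_succ_apply, pow_succ, mul_assoc]
      refine (hKlip _ hxK _ hyK).trans ?_
      gcongr
      exact hlip x hx y hy

lemma Set.OrdConnected.exists_Ioo_subset_of_lt_volume {J : Set ℝ} (hJ : J.OrdConnected) {δ : ℝ}
    (h : ENNReal.ofReal δ < volume J) :
    ∃ a ∈ J, ∃ b ∈ J, δ ≤ b - a ∧ Set.Ioo a b ⊆ J := by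
  have hdiam := h.trans_le (Real.volume_le_diam J)
  obtain ⟨x, hx, y, hy, hxy⟩ : ∃ x ∈ J, ∃ y ∈ J, ENNReal.ofReal δ < edist x y := by
    by_contra! hcon
    exact hdiam.not_ge (Metric.ediam_le hcon)
  rw [edist_dist, Real.dist_eq] at hxy
  have hlt := (ENNReal.ofReal_lt_ofReal_iff').1 hxy |>.1
  rcases le_total x y with hle | hle
  · rw [abs_of_nonpos (by linarith)] at hlt
    exact ⟨x, hx, y, hy, by linarith, Set.Ioo_subset_Icc_self.trans (hJ.out hx hy)⟩
  · rw [abs_of_nonneg (by linarith)] at hlt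
    exact ⟨y, hy, x, hx, by linarith, Set.Ioo_subset_Icc_self.trans (hJ.out hy hx)⟩

/-- Interval growth lemma for the non-Markov map of the half-line.
For every `δ₁ > 0` there are `Ñ ∈ ℕ` and `Γ > 0` such that every interval `J ⊆ (0,∞)`
with `Leb(J) ≥ δ₁` contains an open interval `J′` and there is `N ≤ Ñ` such that:
(a) each `T^k(J′)`, `k < N`, is contained in a single partition element; (b) `T^N(J′)`
contains some partition element; (c) `|T^N(x) − T^N(y)| ≤ Γ^{-N}·|x−y|` on `J′`. -/
theorem Tmap_interval_growth :
    ∀ δ₁ : ℝ, 0 < δ₁ →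
      ∃ (Ntilde : ℕ) (Γ : ℝ), 0 < Γ ∧
        ∀ J : Set ℝ, J.OrdConnected → J ⊆ Set.Ioi 0 →
          ENNReal.ofReal δ₁ ≤ volume J →
          ∃ (N : ℕ) (J' : Set ℝ), N ≤ Ntilde ∧ IsOpen J' ∧ J'.OrdConnected ∧ J' ⊆ J ∧
            (∀ k : ℕ, k < N → ∃ S ∈ Tparts, (Tmap^[k]) '' J' ⊆ S) ∧
            (∃ S ∈ Tparts, S ⊆ (Tmap^[N]) '' J') ∧
            ∀ x ∈ J', ∀ y ∈ J',
              |(Tmap^[N]) x - (Tmap^[N]) y| ≤ (Γ ^ N)⁻¹ * |x - y| := by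
  intro δ₁ hδ₁
  have hδ : 0 < δ₁ / 2 := half_pos hδ₁
  obtain ⟨n, hn⟩ := pow_unbounded_of_one_lt (2 / (δ₁ / 2)) (one_lt_two (α := ℝ))
  rw [div_lt_iff₀ hδ] at hn
  set L : ℝ := max 11 (16 / (δ₁ / 2) ^ 2)
  have hL₁ : 11 ≤ L := le_max_left _ _
  refine ⟨n, L⁻¹, inv_pos.2 (by linarith), fun J hJ hJpos hvol => ?_⟩
  obtain ⟨a, ha, b, -, hab, hsub⟩ := hJ.exists_Ioo_subset_of_lt_volume (δ := δ₁ / 2)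
    (((ENNReal.ofReal_lt_ofReal_iff hδ₁).2 (by linarith)).trans_le hvol)
  obtain ⟨N, J', hN, ho, hc, hJ', hparts, hcover, hlip⟩ :=
    Tmap_Ioo_growth hδ hL₁ (le_max_right _ _) n a b (hJpos ha).le hab
      (hn.le.trans (by gcongr))
  refine ⟨N, J', hN, ho, hc, hJ'.trans hsub, hparts, hcover, ?_⟩
  simpa only [inv_pow, inv_inv] using hlip
end
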